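/- arXiv:1211.2393 — 6 statements merged into one kernel-verified Lean document; each statement's English description precedes it below -/
import Mathlib

section
/- Let n be a positive integer, F a finite field with 2^n elements, α a primitive element of F, and k a positive integer with gcd(2^k − 1, 2^n − 1) = 1. If X is a k-dimensional F_2-subspace of F, then the 2^n − 1 sets α^j · X = { α^j x : x ∈ X } for 0 ≤ j ≤ 2^n − 2 are pairwise distinct k-dimensional F_2-subspaces of F. -/
/-- Two scalars that dilate a finite set of nonzero elements of a field to the same set agree
after raising them to the cardinality of the set. -/
lemma pow_card_eq_pow_card_of_image_mul_eq {K : Type*} [Field K] [DecidableEq K]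
    (S : Finset K) (hS : (0 : K) ∉ S) {a c : K} (ha : a ≠ 0) (hc : c ≠ 0)
    (h : S.image (a * ·) = S.image (c * ·)) : a ^ S.card = c ^ S.card := by
  have hprod : ∏ x ∈ S, x ≠ 0 :=
    Finset.prod_ne_zero_iff.2 fun x hx h0 => hS (h0 ▸ hx)
  have key : ∀ b : K, b ≠ 0 → ∏ x ∈ S.image (b * ·), x = b ^ S.card * ∏ x ∈ S, x := by
    intro b hb
    rw [Finset.prod_image (mul_right_injective₀ hb).injOn, Finset.prod_mul_distrib,
      Finset.prod_const]
  exact mul_right_cancel₀ hprod (by rw [← key a ha, ← key c hc, h])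

/-- Two nonzero scalars that dilate a subspace of a finite field of characteristic two to the
same set have a ratio whose order divides the number of nonzero elements of the subspace. -/
lemma pow_two_pow_finrank_sub_one_eq_of_image_mul_eq {F : Type*} [Field F] [Fintype F]
    [Algebra (ZMod 2) F] (X : Submodule (ZMod 2) F) {a c : F} (ha : a ≠ 0) (hc : c ≠ 0)
    (h : (fun x : F => a * x) '' (X : Set F) = (fun x : F => c * x) '' (X : Set F)) :
    a ^ (2 ^ Module.finrank (ZMod 2) X - 1) = c ^ (2 ^ Module.finrank (ZMod 2) X - 1) := by
  classical
  have hcardX : (X : Set F).toFinset.card = 2 ^ Module.finrank (ZMod 2) X := by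
    rw [Set.toFinset_card, ← Nat.card_eq_fintype_card]
    simpa using Module.natCard_eq_pow_finrank (K := ZMod 2) (V := X)
  have himg : (X : Set F).toFinset.image (a * ·) = (X : Set F).toFinset.image (c * ·) := by
    apply Finset.coe_injective
    simpa using h
  have hzero : (0 : F) ∈ (X : Set F).toFinset := by simp
  rw [← hcardX, ← Finset.card_erase_of_mem hzero]
  refine pow_card_eq_pow_card_of_image_mul_eq _ (Finset.notMem_erase _ _) ha hc ?_
  rw [Finset.image_erase (mul_right_injective₀ ha), Finset.image_erase (mul_right_injective₀ hc),
    himg, mul_zero, mul_zero]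

/-- Let `F` be a finite field with `2 ^ n` elements (`n ≥ 1`), `α` a generator
of its multiplicative group, and `k ≥ 1` with `gcd(2 ^ k - 1, 2 ^ n - 1) = 1`.
If `X` is a `k`-dimensional `𝔽₂`-subspace of `F`, then the `2 ^ n - 1` sets
`α ^ j • X = { α ^ j * x : x ∈ X }` for `0 ≤ j ≤ 2 ^ n - 2` are pairwise
distinct `k`-dimensional `𝔽₂`-subspaces of `F`. -/
theorem cyclic_shifts_distinct_of_gcd_one (n k : ℕ) (hn : 0 < n) (hk : 0 < k)
    (F : Type*) [Field F] [Fintype F] [CharP F 2] [Algebra (ZMod 2) F]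
    (hcard : Fintype.card F = 2 ^ n) (α : F) (hα : orderOf α = 2 ^ n - 1)
    (hgcd : Nat.gcd (2 ^ k - 1) (2 ^ n - 1) = 1)
    (X : Submodule (ZMod 2) F) (hX : Module.finrank (ZMod 2) X = k) :
    (∀ j : ℕ, j ≤ 2 ^ n - 2 → ∃ Y : Submodule (ZMod 2) F,
        (Y : Set F) = (fun x : F => α ^ j * x) '' (X : Set F) ∧
        Module.finrank (ZMod 2) Y = k) ∧
    ∀ j₁ j₂ : ℕ, j₁ ≤ 2 ^ n - 2 → j₂ ≤ 2 ^ n - 2 → j₁ ≠ j₂ →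
      (fun x : F => α ^ j₁ * x) '' (X : Set F) ≠
        (fun x : F => α ^ j₂ * x) '' (X : Set F) := by
  have hpos : 0 < 2 ^ n - 1 := by
    have := Nat.one_lt_two_pow hn.ne'
    omega
  have hα0 : α ≠ 0 := by
    rintro rfl
    have := pow_orderOf_eq_one (0 : F)
    rw [hα, zero_pow hpos.ne'] at this
    exact zero_ne_one this
  refine ⟨fun j _ => ?_, fun j₁ j₂ h₁ h₂ hne heq => hne ?_⟩
  · have hinj : Function.Injective (LinearMap.mulLeft (ZMod 2) (α ^ j)) :=
      mul_right_injective₀ (pow_ne_zero j hα0)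
    exact ⟨X.map (LinearMap.mulLeft (ZMod 2) (α ^ j)), rfl,
      (LinearEquiv.finrank_eq (Submodule.equivMapOfInjective _ hinj X)).symm.trans hX⟩
  · have hc := pow_ne_zero j₂ hα0
    have hk' := pow_two_pow_finrank_sub_one_eq_of_image_mul_eq X (pow_ne_zero j₁ hα0) hc heq
    rw [hX] at hk'
    have hn' : ∀ j, (α ^ j) ^ (2 ^ n - 1) = 1 := fun j => by
      rw [pow_right_comm, ← hα, pow_orderOf_eq_one, one_pow]
    have hratio : α ^ j₁ / α ^ j₂ = 1 := by
      rw [← pow_one (α ^ j₁ / α ^ j₂), ← hgcd, pow_gcd_eq_one]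
      exact ⟨by rw [div_pow, hk', div_self (pow_ne_zero _ hc)],
        by rw [div_pow, hn', hn', div_one]⟩
    exact pow_injOn_Iio_orderOf (by rw [Set.mem_Iio]; omega) (by rw [Set.mem_Iio]; omega)
      ((div_eq_one_iff_eq hc).1 hratio)
end

section
/- Let n be a positive integer, F a finite field with 2^n elements, α a primitive element of F, and X a k-dimensional F_2-subspace of F. Define the difference set Δ(X) ⊆ Z_{2^n−1} as the set of all d ∈ Z_{2^n−1} such that α^d = x·y^(−1) for some distinct nonzero x, y ∈ X. If |Δ(X)| = (2^k − 1)(2^k − 2), then: (a) the 2^n − 1 subspaces α^j · X for 0 ≤ j ≤ 2^n − 2 are pairwise distinct; and (b) the 2-dimensional F_2-subspaces contained in these 2^n − 1 subspaces are all distinct, so that their total number is ((2^k − 1)(2^(k−1) − 1)/3) · (2^n − 1). -/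
/-- The difference set `Δ(X)` of a subspace `X` of `F`, viewed inside
`ℤ/(2 ^ n - 1)ℤ` via exponents `0 ≤ d < 2 ^ n - 1`: those `d` with
`α ^ d = x * y⁻¹` for some distinct nonzero `x, y ∈ X`. -/
def diffSet {F : Type*} [Field F] (n : ℕ) (α : F) (X : Set F) : Set ℕ :=
  {d : ℕ | d < 2 ^ n - 1 ∧
    ∃ x ∈ X, ∃ y ∈ X, x ≠ 0 ∧ y ≠ 0 ∧ x ≠ y ∧ α ^ d = x * y⁻¹}

/-- The ordered pairs of distinct nonzero elements of a subspace `X`. -/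
noncomputable def nonzeroPairs {F : Type*} [Field F] [Fintype F] [Algebra (ZMod 2) F]
    (X : Submodule (ZMod 2) F) : Finset (F × F) := by
  classical
  exact ((Finset.univ.filter (· ∈ X)).erase 0).offDiag

section

variable {F : Type*} [Field F] [Fintype F] [Algebra (ZMod 2) F]

theorem mem_nonzeroPairs {X : Submodule (ZMod 2) F} {p : F × F} :
    p ∈ nonzeroPairs X ↔ (p.1 ≠ 0 ∧ p.1 ∈ X) ∧ (p.2 ≠ 0 ∧ p.2 ∈ X) ∧ p.1 ≠ p.2 := by
  simp [nonzeroPairs]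

theorem card_nonzeroPairs (X : Submodule (ZMod 2) F) :
    (nonzeroPairs X).card =
      (2 ^ Module.finrank (ZMod 2) X - 1) * (2 ^ Module.finrank (ZMod 2) X - 2) := by
  classical
  have h : (Finset.univ.filter (· ∈ X)).card = 2 ^ Module.finrank (ZMod 2) X := by
    have := Module.card_eq_pow_finrank (K := ZMod 2) (V := X)
    rw [ZMod.card] at this
    rw [← this, Fintype.card_subtype]
  rw [nonzeroPairs, Finset.offDiag_card, Finset.card_erase_of_mem (by simp), h]
  generalize 2 ^ Module.finrank (ZMod 2) X = a
  rcases a with _ | _ | a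
  · simp
  · simp
  · simp [Nat.mul_add]

/-- In a complete subspace, an ordered pair of distinct nonzero elements is determined by
its ratio. -/
theorem injOn_ratio_of_complete {n : ℕ} {α : F} (hα : orderOf α = 2 ^ n - 1)
    {X : Submodule (ZMod 2) F}
    (hcomplete : (diffSet n α (X : Set F)).ncard = (nonzeroPairs X).card) :
    Set.InjOn (fun p : F × F => p.1 * p.2⁻¹) (nonzeroPairs X) := by
  classical
  apply Finset.injOn_of_card_image_eq
  apply le_antisymm Finset.card_image_le
  have hinj : Set.InjOn (fun d : ℕ => α ^ d) (diffSet n α (X : Set F)) := by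
    intro a ha b hb h
    exact pow_injOn_Iio_orderOf (by simpa [hα] using ha.1) (by simpa [hα] using hb.1) h
  rw [← hcomplete, ← hinj.ncard_image, ← Set.ncard_coe_finset]
  apply Set.ncard_le_ncard _ (Finset.finite_toSet _)
  rintro _ ⟨d, ⟨-, x, hx, y, hy, hx0, hy0, hxy, h⟩, rfl⟩
  rw [Finset.mem_coe, Finset.mem_image]
  exact ⟨(x, y), mem_nonzeroPairs.2 ⟨⟨hx0, hx⟩, ⟨hy0, hy⟩, hxy⟩, h.symm⟩

/-- If `(x, y)` and `(x', y')` are pairs in a complete subspace whose multiples by `a` and `b`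
agree, then `a = b`. -/
theorem eq_of_smul_pair_eq {X : Submodule (ZMod 2) F}
    (hinj : Set.InjOn (fun p : F × F => p.1 * p.2⁻¹) (nonzeroPairs X)) {a b : F}
    (ha : a ≠ 0) (hb : b ≠ 0) {p q : F × F} (hp : p ∈ nonzeroPairs X)
    (hq₁ : q.1 ∈ X) (hq₂ : q.2 ∈ X)
    (h₁ : a * p.1 = b * q.1) (h₂ : a * p.2 = b * q.2) : a = b := by
  obtain ⟨⟨hp₁, -⟩, ⟨hp₂, -⟩, hne⟩ := mem_nonzeroPairs.1 hp
  have hq₁0 : q.1 ≠ 0 := fun h => by simp_all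
  have hq₂0 : q.2 ≠ 0 := fun h => by simp_all
  have hqne : q.1 ≠ q.2 := fun h => hne (mul_left_cancel₀ ha (by rw [h₁, h₂, h]))
  have hq : q ∈ nonzeroPairs X := mem_nonzeroPairs.2 ⟨⟨hq₁0, hq₁⟩, ⟨hq₂0, hq₂⟩, hqne⟩
  have hpq : p = q := by
    refine hinj hp hq ?_
    change p.1 * p.2⁻¹ = q.1 * q.2⁻¹
    rw [← div_eq_mul_inv, ← div_eq_mul_inv, ← mul_div_mul_left p.1 p.2 ha, h₁, h₂,
      mul_div_mul_left _ _ hb]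
  subst hpq
  exact mul_right_cancel₀ hp₁ h₁

theorem finrank_span_pair_of_mem_nonzeroPairs {X : Submodule (ZMod 2) F} {p : F × F}
    (hp : p ∈ nonzeroPairs X) :
    Module.finrank (ZMod 2) (Submodule.span (ZMod 2) {p.1, p.2}) = 2 := by
  obtain ⟨⟨h₁, -⟩, ⟨h₂, -⟩, hne⟩ := mem_nonzeroPairs.1 hp
  have hli : LinearIndependent (ZMod 2) ![p.1, p.2] := by
    rw [LinearIndependent.pair_iff' h₁]
    intro a
    fin_cases a
    · change (0 : ZMod 2) • p.1 ≠ p.2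
      rwa [zero_smul, ne_comm]
    · change (1 : ZMod 2) • p.1 ≠ p.2
      rwa [one_smul]
  rw [← Matrix.range_cons_cons_empty p.1 p.2 ![], finrank_span_eq_card hli, Fintype.card_fin]

theorem span_pair_eq_of_mem_nonzeroPairs {W : Submodule (ZMod 2) F}
    (hW : Module.finrank (ZMod 2) W = 2) {p : F × F} (hp : p ∈ nonzeroPairs W) :
    Submodule.span (ZMod 2) {p.1, p.2} = W := by
  obtain ⟨⟨-, h₁⟩, ⟨-, h₂⟩, -⟩ := mem_nonzeroPairs.1 hp
  apply Submodule.eq_of_le_of_finrank_le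
  · rw [Submodule.span_le]
    rintro x (rfl | rfl) <;> assumption
  · rw [hW, finrank_span_pair_of_mem_nonzeroPairs hp]

/-- Six times the number of planes of `X` is the number of ordered pairs of distinct nonzero
elements of `X`. -/
theorem six_mul_ncard_planes (X : Submodule (ZMod 2) F) :
    6 * {W : Submodule (ZMod 2) F | Module.finrank (ZMod 2) W = 2 ∧ W ≤ X}.ncard =
      (nonzeroPairs X).card := by
  classical
  have hfin : {W : Submodule (ZMod 2) F | Module.finrank (ZMod 2) W = 2 ∧ W ≤ X}.Finite :=
    Set.toFinite _
  have hmem : ∀ p ∈ nonzeroPairs X, Submodule.span (ZMod 2) {p.1, p.2} ∈ hfin.toFinset := by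
    intro p hp
    obtain ⟨⟨-, h₁⟩, ⟨-, h₂⟩, -⟩ := mem_nonzeroPairs.1 hp
    rw [Set.Finite.mem_toFinset]
    refine ⟨finrank_span_pair_of_mem_nonzeroPairs hp, ?_⟩
    rw [Submodule.span_le]
    rintro x (rfl | rfl) <;> assumption
  rw [Finset.card_eq_sum_card_fiberwise hmem, Set.ncard_eq_toFinset_card _ hfin,
    Finset.sum_const_nat (m := 6), mul_comm]
  intro W hW
  rw [Set.Finite.mem_toFinset] at hW
  obtain ⟨hW₂, hWX⟩ := hW
  have hfiber : {p ∈ nonzeroPairs X | Submodule.span (ZMod 2) {p.1, p.2} = W} =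
      nonzeroPairs W := by
    ext p
    rw [Finset.mem_filter]
    constructor
    · rintro ⟨hp, rfl⟩
      obtain ⟨⟨h₁, -⟩, ⟨h₂, -⟩, h⟩ := mem_nonzeroPairs.1 hp
      exact mem_nonzeroPairs.2 ⟨⟨h₁, Submodule.subset_span (by simp)⟩,
        ⟨h₂, Submodule.subset_span (by simp)⟩, h⟩
    · intro hp
      refine ⟨?_, span_pair_eq_of_mem_nonzeroPairs hW₂ hp⟩
      obtain ⟨⟨h₁, h₁'⟩, ⟨h₂, h₂'⟩, h⟩ := mem_nonzeroPairs.1 hp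
      exact mem_nonzeroPairs.2 ⟨⟨h₁, hWX h₁'⟩, ⟨h₂, hWX h₂'⟩, h⟩
  rw [hfiber, card_nonzeroPairs, hW₂]
  norm_num

end


/-- Let `F` be a finite field with `2 ^ n` elements, `α` a generator of its
multiplicative group, and `X` a `k`-dimensional `𝔽₂`-subspace of `F`. If
`|Δ(X)| = (2 ^ k - 1) * (2 ^ k - 2)`, then (a) the `2 ^ n - 1` subspaces
`α ^ j • X`, `0 ≤ j ≤ 2 ^ n - 2`, are pairwise distinct, and (b) the
2-dimensional `𝔽₂`-subspaces contained in these subspaces are all distinct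
(each lies in at most one shift), so that their total number is
`((2 ^ k - 1) * (2 ^ (k - 1) - 1) / 3) * (2 ^ n - 1)`. -/
theorem complete_subspace_shifts (n k : ℕ) (hn : 0 < n) (hk : 0 < k)
    (F : Type*) [Field F] [Fintype F] [CharP F 2] [Algebra (ZMod 2) F]
    (hcard : Fintype.card F = 2 ^ n) (α : F) (hα : orderOf α = 2 ^ n - 1)
    (X : Submodule (ZMod 2) F) (hX : Module.finrank (ZMod 2) X = k)
    (hcomplete : (diffSet n α (X : Set F)).ncard = (2 ^ k - 1) * (2 ^ k - 2)) :
    (∀ j₁ j₂ : ℕ, j₁ ≤ 2 ^ n - 2 → j₂ ≤ 2 ^ n - 2 → j₁ ≠ j₂ →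
        (fun x : F => α ^ j₁ * x) '' (X : Set F) ≠
          (fun x : F => α ^ j₂ * x) '' (X : Set F)) ∧
    (∀ W : Submodule (ZMod 2) F, Module.finrank (ZMod 2) W = 2 →
        ∀ j₁ j₂ : ℕ, j₁ ≤ 2 ^ n - 2 → j₂ ≤ 2 ^ n - 2 →
          (W : Set F) ⊆ (fun x : F => α ^ j₁ * x) '' (X : Set F) →
          (W : Set F) ⊆ (fun x : F => α ^ j₂ * x) '' (X : Set F) → j₁ = j₂) ∧
    {W : Submodule (ZMod 2) F | Module.finrank (ZMod 2) W = 2 ∧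
        ∃ j : ℕ, j ≤ 2 ^ n - 2 ∧
          (W : Set F) ⊆ (fun x : F => α ^ j * x) '' (X : Set F)}.ncard =
      (2 ^ k - 1) * (2 ^ (k - 1) - 1) / 3 * (2 ^ n - 1) := by
  have hN : 0 < 2 ^ n - 1 := Nat.sub_pos_of_lt (Nat.one_lt_two_pow hn.ne')
  have hα0 : α ≠ 0 := by
    rintro rfl
    rw [orderOf_zero] at hα
    omega
  have hpow : ∀ j : ℕ, α ^ j ≠ 0 := fun j => pow_ne_zero j hα0
  have hlt : ∀ {j : ℕ}, j ≤ 2 ^ n - 2 ↔ j < 2 ^ n - 1 := by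
    intro j
    omega
  have hpowinj : ∀ {i j : ℕ}, i ≤ 2 ^ n - 2 → j ≤ 2 ^ n - 2 → α ^ i = α ^ j → i = j :=
    fun hi hj h => pow_injOn_Iio_orderOf (by simpa [hα] using hlt.1 hi)
      (by simpa [hα] using hlt.1 hj) h
  have hinj := injOn_ratio_of_complete hα (by rw [hcomplete, card_nonzeroPairs, hX])
  have hshift : ∀ W : Submodule (ZMod 2) F, Module.finrank (ZMod 2) W = 2 →
      ∀ j₁ j₂ : ℕ, j₁ ≤ 2 ^ n - 2 → j₂ ≤ 2 ^ n - 2 →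
        (W : Set F) ⊆ (fun x : F => α ^ j₁ * x) '' (X : Set F) →
        (W : Set F) ⊆ (fun x : F => α ^ j₂ * x) '' (X : Set F) → j₁ = j₂ := by
    intro W hW j₁ j₂ hj₁ hj₂ h₁ h₂
    obtain ⟨⟨u, v⟩, huv⟩ : (nonzeroPairs W).Nonempty := by
      rw [← Finset.card_pos, card_nonzeroPairs, hW]
      norm_num
    obtain ⟨⟨hu0, hu⟩, ⟨hv0, hv⟩, hne⟩ := mem_nonzeroPairs.1 huv
    obtain ⟨x, hx, hxu⟩ := h₁ hu
    obtain ⟨y, hy, hyv⟩ := h₁ hv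
    obtain ⟨x', hx', hxu'⟩ := h₂ hu
    obtain ⟨y', hy', hyv'⟩ := h₂ hv
    dsimp only at hxu hyv hxu' hyv' hu0 hv0 hne
    refine hpowinj hj₁ hj₂ (eq_of_smul_pair_eq hinj (hpow _) (hpow _) (p := (x, y))
      (q := (x', y')) (mem_nonzeroPairs.2 ⟨⟨?_, hx⟩, ⟨?_, hy⟩, ?_⟩) hx' hy'
      (hxu.trans hxu'.symm) (hyv.trans hyv'.symm))
    · rintro rfl
      exact hu0 (by rw [← hxu, mul_zero])
    · rintro rfl
      exact hv0 (by rw [← hyv, mul_zero])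
    · intro hxy
      change x = y at hxy
      exact hne (by rw [← hxu, ← hyv, hxy])
  refine ⟨?_, hshift, ?_⟩
  · intro j₁ j₂ hj₁ hj₂ hne heq
    apply hne
    have hXbot : X ≠ ⊥ := by
      rintro rfl
      rw [finrank_bot] at hX
      omega
    obtain ⟨x, hx, hx0⟩ := X.ne_bot_iff.1 hXbot
    obtain ⟨y, hy, hxy⟩ := heq.subset ⟨x, hx, rfl⟩
    obtain ⟨z, hz, hyz⟩ := heq.subset ⟨y, hy, rfl⟩
    dsimp only at hxy hyz
    apply hpowinj hj₁ hj₂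
    by_cases hxy' : x = y
    · subst hxy'
      exact (mul_right_cancel₀ hx0 hxy).symm
    · have hy0 : y ≠ 0 := by
        rintro rfl
        rw [mul_zero] at hxy
        exact mul_ne_zero (hpow _) hx0 hxy.symm
      exact eq_of_smul_pair_eq hinj (hpow _) (hpow _) (p := (x, y)) (q := (y, z))
        (mem_nonzeroPairs.2 ⟨⟨hx0, hx⟩, ⟨hy0, hy⟩, hxy'⟩) hy hz hxy.symm hyz.symm
  · have hmulinj : ∀ j : ℕ, Function.Injective (LinearMap.mulLeft (ZMod 2) (α ^ j)) :=
      fun j => mul_right_injective₀ (hpow j)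
    have hfinrank : ∀ (j : ℕ) (W : Submodule (ZMod 2) F),
        Module.finrank (ZMod 2) (W.map (LinearMap.mulLeft (ZMod 2) (α ^ j))) =
          Module.finrank (ZMod 2) W :=
      fun j W => (Submodule.equivMapOfInjective _ (hmulinj j) W).finrank_eq.symm
    have himage : {W : Submodule (ZMod 2) F | Module.finrank (ZMod 2) W = 2 ∧
          ∃ j : ℕ, j ≤ 2 ^ n - 2 ∧ (W : Set F) ⊆ (fun x : F => α ^ j * x) '' (X : Set F)} =
        (fun p : Submodule (ZMod 2) F × ℕ => p.1.map (LinearMap.mulLeft (ZMod 2) (α ^ p.2))) ''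
          ({W : Submodule (ZMod 2) F | Module.finrank (ZMod 2) W = 2 ∧ W ≤ X} ×ˢ
            Set.Iio (2 ^ n - 1)) := by
      ext W
      constructor
      · rintro ⟨hW, j, hj, hWX⟩
        have hWX' : W ≤ X.map (LinearMap.mulLeft (ZMod 2) (α ^ j)) := hWX
        have hmap : (W.comap (LinearMap.mulLeft (ZMod 2) (α ^ j))).map
            (LinearMap.mulLeft (ZMod 2) (α ^ j)) = W :=
          Submodule.map_comap_eq_of_le (hWX'.trans LinearMap.map_le_range)
        refine ⟨(W.comap (LinearMap.mulLeft (ZMod 2) (α ^ j)), j), ⟨⟨?_, ?_⟩, hlt.1 hj⟩, hmap⟩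
        · rw [← hfinrank j, hmap, hW]
        · rwa [← Submodule.map_le_map_iff_of_injective (hmulinj j), hmap]
      · rintro ⟨⟨V, j⟩, ⟨⟨hV, hVX⟩, hj⟩, rfl⟩
        exact ⟨(hfinrank j V).trans hV, j, hlt.2 hj, Set.image_mono hVX⟩
    have hinjOn : Set.InjOn
        (fun p : Submodule (ZMod 2) F × ℕ => p.1.map (LinearMap.mulLeft (ZMod 2) (α ^ p.2)))
        ({W : Submodule (ZMod 2) F | Module.finrank (ZMod 2) W = 2 ∧ W ≤ X} ×ˢ
            Set.Iio (2 ^ n - 1)) := by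
      rintro ⟨V, i⟩ ⟨⟨hV, hVX⟩, hi⟩ ⟨V', j⟩ ⟨⟨-, hVX'⟩, hj⟩ h
      dsimp only at h hi hj hVX hVX' hV
      obtain rfl : i = j := hshift _ ((hfinrank i V).trans hV) i j (hlt.2 hi) (hlt.2 hj)
        (Set.image_mono hVX) (by rw [h]; exact Set.image_mono hVX')
      rw [Submodule.map_injective_of_injective (hmulinj i) h]
    have hplanes := six_mul_ncard_planes X
    rw [card_nonzeroPairs, hX] at hplanes
    rw [himage, hinjOn.ncard_image, Set.ncard_prod, Set.ncard_Iio_nat]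
    congr 1
    obtain ⟨m, rfl⟩ : ∃ m, k = m + 1 := ⟨k - 1, by omega⟩
    have htwo : 2 ^ (m + 1) - 2 = 2 * (2 ^ m - 1) := by
      rw [pow_succ]
      omega
    rw [htwo, mul_left_comm] at hplanes
    rw [Nat.add_sub_cancel]
    omega
end

section
/- Let F be a finite field with 2^13 elements and α a primitive element of F. There exist 15 three-dimensional F_2-subspaces X₁, …, X₁₅ of F that are pairwise disjoint coset complete, i.e. each |ρ(Δ(X_i))| = 42 = (2^3 − 1)(2^3 − 2), and ρ(Δ(X_i)) ∩ ρ(Δ(X_j)) = ∅ for all i ≠ j. -/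
/-- `rho n d` is the coset representative (smallest element) of the cyclotomic
coset `C_d = { d * 2 ^ i mod (2 ^ n - 1) : 0 ≤ i ≤ n - 1 }`. -/
noncomputable def rho (n d : ℕ) : ℕ :=
  sInf {r : ℕ | ∃ i : ℕ, i ≤ n - 1 ∧ r = d * 2 ^ i % (2 ^ n - 1)}

namespace CosetComplete

/-! ### Arithmetic modulo `x ^ 13 + x ^ 12 + x ^ 10 + x ^ 9 + 1` on binary words -/

/-- The value at `b` of the binary polynomial whose coefficients are the low 13 bits of `v`. -/
def wordValue {R : Type*} [CommRing R] (b : R) (v : ℕ) : R :=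
  ∑ i ∈ Finset.range 13, if v.testBit i then b ^ i else 0

/-- Multiplication by the variable, reduced modulo the polynomial. -/
def shift (v : ℕ) : ℕ :=
  (2 * v ^^^ if v.testBit 12 then 5633 else 0) % 2 ^ 13

/-- Sum of `x ^ i * v` over the bits `i < k` set in `w`. -/
def mulBits (v w : ℕ) : ℕ → ℕ
  | 0 => 0
  | k + 1 => mulBits v w k ^^^ if w.testBit k then shift^[k] v else 0

/-- The word of `x ^ n` for `n < 2 ^ k`, by repeated squaring. -/
def powWord : ℕ → ℕ → ℕ
  | 0, _ => 1
  | k + 1, n =>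
    let s := mulBits (powWord k (n / 2)) (powWord k (n / 2)) 13
    if n % 2 = 1 then shift s else s

section Eval

variable {R : Type*} [CommRing R] {b : R}

lemma wordValue_zero : wordValue b 0 = 0 := by simp [wordValue]

lemma wordValue_one : wordValue b 1 = 1 := by
  simp [wordValue, Finset.sum_range_succ, Nat.testBit, Nat.shiftRight_eq_div_pow]

lemma wordValue_two : wordValue b 2 = b := by
  simp [wordValue, Finset.sum_range_succ, Nat.testBit, Nat.shiftRight_eq_div_pow]

lemma wordValue_mod (v : ℕ) : wordValue b (v % 2 ^ 13) = wordValue b v := by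
  refine Finset.sum_congr rfl fun i hi => ?_
  simp only [Nat.testBit_mod_two_pow, Finset.mem_range.mp hi, decide_true, Bool.true_and]

lemma wordValue_xor (h2 : (2 : R) = 0) (v w : ℕ) :
    wordValue b (v ^^^ w) = wordValue b v + wordValue b w := by
  simp only [wordValue, ← Finset.sum_add_distrib]
  refine Finset.sum_congr rfl fun i _ => ?_
  rw [Nat.testBit_xor]
  cases v.testBit i <;> cases w.testBit i <;> simp
  linear_combination -b ^ i * h2

lemma wordValue_shift (h2 : (2 : R) = 0) (hb : b ^ 13 + b ^ 12 + b ^ 10 + b ^ 9 + 1 = 0) (v : ℕ) :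
    wordValue b (shift v) = b * wordValue b v := by
  have hred : wordValue b 5633 = b ^ 13 := by
    have : wordValue b 5633 = 1 + b ^ 9 + b ^ 10 + b ^ 12 := by
      simp [wordValue, Finset.sum_range_succ, Nat.testBit, Nat.shiftRight_eq_div_pow]
    linear_combination this + hb - b ^ 13 * h2
  have hdouble : wordValue b (2 * v) + (if v.testBit 12 then b ^ 13 else 0) = b * wordValue b v := by
    rw [wordValue, wordValue, Finset.sum_range_succ', Finset.sum_range_succ _ 12,
      mul_add, Finset.mul_sum]
    congr 1
    · rw [show (2 * v).testBit 0 = false by simp]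
      simp only [Bool.false_eq_true, if_false, add_zero]
      refine Finset.sum_congr rfl fun i _ => ?_
      rw [Nat.testBit_succ, Nat.mul_div_cancel_left _ two_pos, mul_ite, mul_zero, pow_succ']
    · rw [mul_ite, mul_zero, ← pow_succ']
  rw [shift, wordValue_mod, wordValue_xor h2, apply_ite (wordValue b), hred,
      wordValue_zero, hdouble]

lemma wordValue_mulBits (h2 : (2 : R) = 0) (hb : b ^ 13 + b ^ 12 + b ^ 10 + b ^ 9 + 1 = 0)
    (v w : ℕ) : wordValue b (mulBits v w 13) = wordValue b v * wordValue b w := by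
  have hiter (k : ℕ) : wordValue b (shift^[k] v) = b ^ k * wordValue b v := by
    induction k with
    | zero => simp
    | succ k ih =>
      rw [Function.iterate_succ_apply', wordValue_shift h2 hb, ih, pow_succ', mul_assoc]
  have hpart (k : ℕ) : wordValue b (mulBits v w k) =
      wordValue b v * ∑ i ∈ Finset.range k, if w.testBit i then b ^ i else 0 := by
    induction k with
    | zero => simp [mulBits, wordValue_zero]
    | succ k ih =>
      rw [mulBits, wordValue_xor h2, ih, Finset.sum_range_succ, mul_add,
        apply_ite (wordValue b), hiter, wordValue_zero, mul_ite, mul_zero, mul_comm (b ^ k)]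
  exact hpart 13

lemma wordValue_powWord (h2 : (2 : R) = 0) (hb : b ^ 13 + b ^ 12 + b ^ 10 + b ^ 9 + 1 = 0)
    (k n : ℕ) (hn : n < 2 ^ k) : wordValue b (powWord k n) = b ^ n := by
  induction k generalizing n with
  | zero =>
    obtain rfl : n = 0 := by simpa using hn
    rw [powWord, wordValue_one, pow_zero]
  | succ k ih =>
    have hsq : wordValue b (mulBits (powWord k (n / 2)) (powWord k (n / 2)) 13) =
        b ^ (2 * (n / 2)) := by
      rw [wordValue_mulBits h2 hb, ih _ (by omega), two_mul, pow_add]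
    rw [powWord]
    split_ifs with h
    · rw [wordValue_shift h2 hb, hsq, ← pow_succ']
      congr 1
      omega
    · rw [hsq]
      congr 1
      omega

end Eval

lemma powWord_two_pow : powWord 14 (2 ^ 13) = 2 := by decide +kernel

/-! ### A root of the polynomial in a field with `2 ^ 13` elements -/

open Polynomial in
lemma exists_root (F : Type*) [Field F] [Fintype F] (h2 : (2 : F) = 0)
    (hcard : Fintype.card F = 2 ^ 13) :
    ∃ b : F, b ^ 13 + b ^ 12 + b ^ 10 + b ^ 9 + 1 = 0 := by
  set p : F[X] := X ^ 13 + X ^ 12 + X ^ 10 + X ^ 9 + 1 with hp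
  have hdvd : p ∣ X ^ Fintype.card F - X := by
    rw [← AdjoinRoot.mk_eq_zero, hcard, map_sub, map_pow, AdjoinRoot.mk_X, sub_eq_zero]
    have h2' : (2 : AdjoinRoot p) = 0 := by
      rw [← map_ofNat (AdjoinRoot.of p) 2, h2, map_zero]
    have hroot : (AdjoinRoot.root p) ^ 13 + AdjoinRoot.root p ^ 12 + AdjoinRoot.root p ^ 10
        + AdjoinRoot.root p ^ 9 + 1 = 0 := by
      simpa [hp] using AdjoinRoot.eval₂_root p
    rw [← wordValue_powWord h2' hroot 14 _ (by norm_num), powWord_two_pow, wordValue_two]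
  have hne : (X ^ Fintype.card F - X : F[X]) ≠ 0 :=
    FiniteField.X_pow_card_sub_X_ne_zero F Fintype.one_lt_card
  have hsplit : (X ^ Fintype.card F - X : F[X]).Splits := by
    rw [splits_iff_card_roots, FiniteField.roots_X_pow_card_sub_X,
      FiniteField.X_pow_card_sub_X_natDegree_eq F Fintype.one_lt_card]
    rfl
  have hdeg : p.degree = 13 := by
    rw [hp]
    compute_degree!
  obtain ⟨b, hb⟩ := (hsplit.of_dvd hne hdvd).exists_eval_eq_zero (by rw [hdeg]; decide)
  exact ⟨b, by simpa [hp] using hb⟩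

lemma orderOf_root {F : Type*} [Field F] [Fintype F] (h2 : (2 : F) = 0)
    (hcard : Fintype.card F = 2 ^ 13) {b : F}
    (hb : b ^ 13 + b ^ 12 + b ^ 10 + b ^ 9 + 1 = 0) : orderOf b = 8191 := by
  have : Fact (Nat.Prime 8191) := ⟨by norm_num⟩
  refine orderOf_eq_prime ?_ ?_
  · have := FiniteField.pow_card_sub_one_eq_one b (by rintro rfl; simp at hb)
    rwa [hcard] at this
  · rintro rfl
    exact one_ne_zero (α := F) (by linear_combination hb - 2 * h2)

/-! ### Cyclotomic cosets -/

/-- The minimum of `m * 2 ^ i % 8191` over `i ≤ k`. -/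
def orbitMin (m : ℕ) : ℕ → ℕ
  | 0 => m % 8191
  | k + 1 => min (orbitMin m k) (m * 2 ^ (k + 1) % 8191)

lemma orbitMin_le (m : ℕ) {k i : ℕ} (hi : i ≤ k) : orbitMin m k ≤ m * 2 ^ i % 8191 := by
  induction k with
  | zero =>
    obtain rfl : i = 0 := by omega
    simp [orbitMin]
  | succ k ih =>
    rcases Nat.le_succ_iff.mp hi with h | rfl
    · exact (min_le_left _ _).trans (ih h)
    · exact min_le_right _ _

lemma exists_orbitMin_eq (m k : ℕ) : ∃ i, orbitMin m k = m * 2 ^ i % 8191 := by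
  induction k with
  | zero => exact ⟨0, by simp [orbitMin]⟩
  | succ k ih =>
    rcases min_choice (orbitMin m k) (m * 2 ^ (k + 1) % 8191) with h | h
    · rwa [orbitMin, h]
    · exact ⟨k + 1, h⟩

lemma two_pow_modEq (q i : ℕ) : 2 ^ (13 * q + i) ≡ 2 ^ i [MOD 8191] := by
  have h : 2 ^ 13 ≡ 1 [MOD 8191] := rfl
  simpa [pow_add, pow_mul] using (h.pow q).mul_right (2 ^ i)

lemma orbitMin_le_of_modEq {m m' i j : ℕ} (h : m * 2 ^ i ≡ m' * 2 ^ j [MOD 8191]) :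
    orbitMin m 12 ≤ orbitMin m' 12 := by
  obtain ⟨l, hl⟩ := exists_orbitMin_eq m' 12
  have hm : m * 2 ^ ((i + (12 * j + l)) % 13) ≡ m' * 2 ^ l [MOD 8191] := calc
    m * 2 ^ ((i + (12 * j + l)) % 13)
      ≡ m * 2 ^ (13 * ((i + (12 * j + l)) / 13) + (i + (12 * j + l)) % 13) [MOD 8191] :=
        ((two_pow_modEq _ _).symm).mul_left m
    _ = m * 2 ^ i * 2 ^ (12 * j + l) := by rw [Nat.div_add_mod, pow_add, mul_assoc]
    _ ≡ m' * 2 ^ j * 2 ^ (12 * j + l) [MOD 8191] := h.mul_right _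
    _ = m' * 2 ^ (13 * j + l) := by ring
    _ ≡ m' * 2 ^ l [MOD 8191] := (two_pow_modEq _ _).mul_left m'
  rw [hl, ← hm]
  exact orbitMin_le m (by omega)

lemma orbitMin_eq_of_modEq {m m' i j : ℕ} (h : m * 2 ^ i ≡ m' * 2 ^ j [MOD 8191]) :
    orbitMin m 12 = orbitMin m' 12 :=
  (orbitMin_le_of_modEq h).antisymm (orbitMin_le_of_modEq h.symm)

lemma exists_rho_eq (d : ℕ) : ∃ i, rho 13 d = d * 2 ^ i % 8191 := by
  have hne : {r : ℕ | ∃ i : ℕ, i ≤ 13 - 1 ∧ r = d * 2 ^ i % (2 ^ 13 - 1)}.Nonempty :=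
    ⟨_, 0, by omega, rfl⟩
  obtain ⟨i, -, hi⟩ := Nat.sInf_mem hne
  exact ⟨i, hi⟩

/-! ### The fifteen subspaces -/

/-- Exponents of the nonzero elements of the subspaces, as powers of a root of the polynomial. -/
def block : Fin 15 → List ℕ := ![
  [0, 1, 1249, 5040, 7258, 7978, 8105],
  [0, 7, 1857, 6681, 7259, 7381, 7908],
  [0, 9, 1144, 1945, 6771, 7714, 8102],
  [0, 11, 209, 1941, 2926, 3565, 6579],
  [0, 12, 2181, 2519, 3696, 6673, 6965],
  [0, 13, 4821, 5178, 7823, 8052, 8110],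
  [0, 17, 291, 1199, 5132, 6266, 8057],
  [0, 20, 1075, 3939, 3996, 4776, 7313],
  [0, 21, 2900, 4226, 4915, 6087, 8008],
  [0, 27, 1190, 3572, 4989, 5199, 6710],
  [0, 30, 141, 682, 2024, 6256, 6406],
  [0, 31, 814, 1161, 1243, 4434, 6254],
  [0, 37, 258, 2093, 4703, 5396, 6469],
  [0, 115, 949, 1272, 1580, 4539, 4873],
  [0, 119, 490, 5941, 6670, 6812, 7312]]

lemma block_lt : ∀ i, ∀ x ∈ block i, x < 8191 := by decide +kernel

lemma card_block : ∀ i, (block i).toFinset.card = 7 := by decide +kernel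

lemma block_closed : ∀ i, ∀ x ∈ block i, ∀ y ∈ block i,
    x = y ∨ ∃ z ∈ block i, powWord 13 x ^^^ powWord 13 y = powWord 13 z := by
  decide +kernel

/-- Ordered pairs of distinct exponents from a common block. -/
def pairs : List (Fin 15 × ℕ × ℕ) :=
  (List.finRange 15).flatMap fun i => (block i).flatMap fun x =>
    ((block i).filter (· ≠ x)).map fun y => (i, x, y)

lemma mem_pairs {i : Fin 15} {x y : ℕ} :
    (i, x, y) ∈ pairs ↔ x ∈ block i ∧ y ∈ block i ∧ x ≠ y := by
  simp only [pairs, List.mem_flatMap, List.mem_map, List.mem_filter, List.mem_finRange,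
    true_and, Prod.mk.injEq, decide_eq_true_eq]
  constructor
  · rintro ⟨i, x, hx, y, ⟨hy, hne⟩, rfl, rfl, rfl⟩
    exact ⟨hx, hy, hne.symm⟩
  · rintro ⟨hx, hy, hne⟩
    exact ⟨i, x, hx, y, ⟨hy, hne.symm⟩, rfl, rfl, rfl⟩

/-- Whether the entries of a list are distinct and avoid the bits set in `s`. -/
def distinctAvoiding : List ℕ → ℕ → Bool
  | [], _ => true
  | a :: l, s => !s.testBit a && distinctAvoiding l (s ||| 2 ^ a)

lemma nodup_of_distinctAvoiding {l : List ℕ} {s : ℕ} (h : distinctAvoiding l s = true) :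
    l.Nodup ∧ ∀ a ∈ l, s.testBit a = false := by
  induction l generalizing s with
  | nil => simp
  | cons a l ih =>
    simp only [distinctAvoiding, Bool.and_eq_true, Bool.not_eq_true'] at h
    obtain ⟨hnodup, havoid⟩ := ih h.2
    simp only [Nat.testBit_or, Bool.or_eq_false_iff] at havoid
    refine ⟨List.nodup_cons.mpr ⟨fun ha => ?_, hnodup⟩, ?_⟩
    · simpa using (havoid a ha).2
    · rintro c (_ | ⟨_, hc⟩)
      · exact h.1
      · exact (havoid c hc).1

lemma nodup_orbitMin :
    (pairs.map fun t => orbitMin (t.2.1 + (8191 - t.2.2)) 12).Nodup :=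
  (nodup_of_distinctAvoiding (s := 0) (by decide +kernel)).1

lemma ne_zero_of_orderOf {F : Type*} [Field F] {b : F} (hord : orderOf b = 8191) : b ≠ 0 := by
  rintro rfl
  simp at hord

lemma pow_injOn_block {F : Type*} [Field F] {b : F} (hord : orderOf b = 8191)
    (i : Fin 15) : Set.InjOn (fun x => b ^ x) {x | x ∈ block i} := fun x hx y hy h =>
  pow_injOn_Iio_orderOf (by simpa [hord] using block_lt i x hx)
    (by simpa [hord] using block_lt i y hy) h

/-- Members of difference sets with equal coset representatives come from the same pair. -/
lemma eq_of_rho_eq {F : Type*} [Field F] {b α : F} (hord : orderOf b = 8191) {k : ℕ}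
    (hk : b ^ k = α) {t t' : Fin 15 × ℕ × ℕ} (ht : t ∈ pairs) (ht' : t' ∈ pairs) {d d' : ℕ}
    (hd : α ^ d = b ^ t.2.1 * (b ^ t.2.2)⁻¹) (hd' : α ^ d' = b ^ t'.2.1 * (b ^ t'.2.2)⁻¹)
    (h : rho 13 d = rho 13 d') : t = t' := by
  have key {t : Fin 15 × ℕ × ℕ} (ht : t ∈ pairs) {d : ℕ}
      (hd : α ^ d = b ^ t.2.1 * (b ^ t.2.2)⁻¹) :
      t.2.1 + (8191 - t.2.2) ≡ k * d [MOD 8191] := by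
    have hfin : IsOfFinOrder b := orderOf_pos_iff.mp (by omega)
    suffices h : b ^ (t.2.1 + (8191 - t.2.2)) = b ^ (k * d) by
      rwa [hfin.pow_eq_pow_iff_modEq, hord] at h
    rw [pow_mul, hk, hd, pow_add]
    congr 1
    refine eq_inv_of_mul_eq_one_left ?_
    rw [← pow_add, Nat.sub_add_cancel (block_lt _ _ (mem_pairs.mp ht).2.1).le, ← hord,
      pow_orderOf_eq_one]
  obtain ⟨i, hi⟩ := exists_rho_eq d
  obtain ⟨j, hj⟩ := exists_rho_eq d'
  have hdd : d * 2 ^ i ≡ d' * 2 ^ j [MOD 8191] := by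
    rw [Nat.ModEq, ← hi, ← hj, h]
  refine List.inj_on_of_nodup_map nodup_orbitMin ht ht' (orbitMin_eq_of_modEq (i := i) (j := j) ?_)
  calc (t.2.1 + (8191 - t.2.2)) * 2 ^ i
      ≡ k * d * 2 ^ i [MOD 8191] := (key ht hd).mul_right _
    _ = k * (d * 2 ^ i) := mul_assoc _ _ _
    _ ≡ k * (d' * 2 ^ j) [MOD 8191] := hdd.mul_left k
    _ = k * d' * 2 ^ j := (mul_assoc _ _ _).symm
    _ ≡ (t'.2.1 + (8191 - t'.2.2)) * 2 ^ j [MOD 8191] := ((key ht' hd').symm).mul_right _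

/-- The subspace whose nonzero elements are the powers of `b` with exponents in `block i`. -/
def blockSpace {F : Type*} [Field F] [Algebra (ZMod 2) F] (h2 : (2 : F) = 0) {b : F}
    (hb : b ^ 13 + b ^ 12 + b ^ 10 + b ^ 9 + 1 = 0) (i : Fin 15) : Submodule (ZMod 2) F where
  carrier := {v | v = 0 ∨ ∃ x ∈ block i, v = b ^ x}
  zero_mem' := Or.inl rfl
  add_mem' := by
    rintro _ _ (rfl | ⟨x, hx, rfl⟩) (rfl | ⟨y, hy, rfl⟩)
    · exact Or.inl (add_zero 0)
    · exact Or.inr ⟨y, hy, zero_add _⟩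
    · exact Or.inr ⟨x, hx, add_zero _⟩
    · rcases block_closed i x hx y hy with rfl | ⟨z, hz, h⟩
      · exact Or.inl (by linear_combination b ^ x * h2)
      · refine Or.inr ⟨z, hz, ?_⟩
        have hlt {e : ℕ} (he : e ∈ block i) : e < 2 ^ 13 := (block_lt i e he).trans (by norm_num)
        rw [← wordValue_powWord h2 hb 13 x (hlt hx), ← wordValue_powWord h2 hb 13 y (hlt hy),
          ← wordValue_powWord h2 hb 13 z (hlt hz), ← wordValue_xor h2, h]
  smul_mem' := by
    intro c v hv
    obtain rfl | rfl : c = 0 ∨ c = 1 := by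
      revert c
      decide
    · exact Or.inl (zero_smul _ v)
    · rwa [one_smul]

section BlockSpace

variable {F : Type*} [Field F] [Algebra (ZMod 2) F] (h2 : (2 : F) = 0) {b : F}
  (hb : b ^ 13 + b ^ 12 + b ^ 10 + b ^ 9 + 1 = 0)

lemma mem_blockSpace {i : Fin 15} {v : F} :
    v ∈ blockSpace h2 hb i ↔ v = 0 ∨ ∃ x ∈ block i, v = b ^ x := Iff.rfl

lemma finrank_blockSpace (hord : orderOf b = 8191) (i : Fin 15) :
    Module.finrank (ZMod 2) (blockSpace h2 hb i) = 3 := by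
  classical
  have hb0 := ne_zero_of_orderOf hord
  have hset : (blockSpace h2 hb i : Set F) =
      ↑(insert 0 ((block i).toFinset.image fun x => b ^ x)) := by
    ext v
    simp [mem_blockSpace, eq_comm]
  have hcard : Nat.card (blockSpace h2 hb i) = 8 := by
    change Nat.card ↥(blockSpace h2 hb i : Set F) = 8
    rw [hset, Nat.card_coe_set_eq, Set.ncard_coe_finset, Finset.card_insert_of_notMem,
      Finset.card_image_of_injOn, card_block]
    · simpa using pow_injOn_block hord i
    · simp [hb0]
  have : Finite (blockSpace h2 hb i) := Nat.finite_of_card_ne_zero (by omega)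
  have h := Module.natCard_eq_pow_finrank (K := ZMod 2) (V := blockSpace h2 hb i)
  rw [hcard, Nat.card_zmod] at h
  exact (Nat.pow_right_injective le_rfl (show 2 ^ 3 = _ from h)).symm

lemma mem_diffSet_blockSpace {α : F} (hord : orderOf b = 8191) {i : Fin 15} {d : ℕ} :
    d ∈ diffSet 13 α (blockSpace h2 hb i : Set F) ↔
      d < 8191 ∧ ∃ x y, (i, x, y) ∈ pairs ∧ α ^ d = b ^ x * (b ^ y)⁻¹ := by
  have hb0 := ne_zero_of_orderOf hord
  refine and_congr Iff.rfl ⟨?_, ?_⟩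
  · rintro ⟨u, hu, v, hv, hu0, hv0, hne, h⟩
    obtain ⟨x, hx, rfl⟩ := ((mem_blockSpace h2 hb).mp hu).resolve_left hu0
    obtain ⟨y, hy, rfl⟩ := ((mem_blockSpace h2 hb).mp hv).resolve_left hv0
    exact ⟨x, y, mem_pairs.mpr ⟨hx, hy, fun hxy => hne (by rw [hxy])⟩, h⟩
  · rintro ⟨x, y, hxy, h⟩
    obtain ⟨hx, hy, hne⟩ := mem_pairs.mp hxy
    exact ⟨b ^ x, Or.inr ⟨x, hx, rfl⟩, b ^ y, Or.inr ⟨y, hy, rfl⟩, pow_ne_zero _ hb0,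
      pow_ne_zero _ hb0, fun h => hne (pow_injOn_block hord i hx hy h), h⟩

lemma ncard_rho_image_diffSet {α : F} (hα : orderOf α = 8191) {k : ℕ} (hk : b ^ k = α)
    (hord : orderOf b = 8191) (hlog : ∀ v : F, v ≠ 0 → ∃ d < 8191, α ^ d = v) (i : Fin 15) :
    (rho 13 '' diffSet 13 α (blockSpace h2 hb i : Set F)).ncard = 42 := by
  have hb0 := ne_zero_of_orderOf hord
  choose! log hlog_lt hlog_eq using hlog
  have hratio (q : ℕ × ℕ) : b ^ q.1 * (b ^ q.2)⁻¹ ≠ 0 :=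
    mul_ne_zero (pow_ne_zero _ hb0) (inv_ne_zero (pow_ne_zero _ hb0))
  set f : ℕ × ℕ → ℕ := fun q => rho 13 (log (b ^ q.1 * (b ^ q.2)⁻¹)) with hf
  have hmem {q : ℕ × ℕ} : q ∈ (block i).toFinset.offDiag ↔ (i, q) ∈ pairs := by
    rw [Finset.mem_offDiag, List.mem_toFinset, List.mem_toFinset, mem_pairs]
  have himage : rho 13 '' diffSet 13 α (blockSpace h2 hb i : Set F) =
      f '' ↑(block i).toFinset.offDiag := by
    ext r
    constructor
    · rintro ⟨d, hd, rfl⟩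
      obtain ⟨hlt, x, y, hxy, h⟩ := (mem_diffSet_blockSpace h2 hb hord).mp hd
      refine ⟨(x, y), hmem.mpr hxy, ?_⟩
      refine congrArg (rho 13) (pow_injOn_Iio_orderOf (x := α) ?_ ?_
        ((hlog_eq _ (hratio (x, y))).trans h.symm))
      · simpa [hα] using hlog_lt _ (hratio (x, y))
      · simpa [hα] using hlt
    · rintro ⟨q, hq, rfl⟩
      exact ⟨_, (mem_diffSet_blockSpace h2 hb hord).mpr
        ⟨hlog_lt _ (hratio q), q.1, q.2, hmem.mp hq, hlog_eq _ (hratio q)⟩, rfl⟩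
  have hinj : Set.InjOn f ↑(block i).toFinset.offDiag := fun q hq q' hq' h =>
    (Prod.mk.inj (eq_of_rho_eq hord hk (hmem.mp hq) (hmem.mp hq') (hlog_eq _ (hratio q))
      (hlog_eq _ (hratio q')) h)).2
  rw [himage, hinj.ncard_image, Set.ncard_coe_finset, Finset.offDiag_card,
    card_block]

lemma disjoint_rho_image_diffSet {α : F} {k : ℕ} (hk : b ^ k = α) (hord : orderOf b = 8191)
    {i j : Fin 15} (hij : i ≠ j) :
    (rho 13 '' diffSet 13 α (blockSpace h2 hb i : Set F)) ∩
      (rho 13 '' diffSet 13 α (blockSpace h2 hb j : Set F)) = ∅ := by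
  rw [Set.eq_empty_iff_forall_notMem]
  rintro _ ⟨⟨d, hd, rfl⟩, d', hd', h⟩
  obtain ⟨-, x, y, hxy, hxd⟩ := (mem_diffSet_blockSpace h2 hb hord).mp hd
  obtain ⟨-, x', y', hxy', hxd'⟩ := (mem_diffSet_blockSpace h2 hb hord).mp hd'
  exact hij (Prod.mk.inj (eq_of_rho_eq hord hk hxy hxy' hxd hxd' h.symm)).1

end BlockSpace

/-- In a field with `2 ^ 13` elements every nonzero element is a power of an element of order
`2 ^ 13 - 1`. -/
lemma exists_pow_eq {F : Type*} [Field F] [Fintype F] (hcard : Fintype.card F = 2 ^ 13) {c : F}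
    (hc : orderOf c = 8191) (v : F) (hv : v ≠ 0) : ∃ d < 8191, c ^ d = v := by
  have hprim : IsPrimitiveRoot c 8191 := hc ▸ IsPrimitiveRoot.orderOf c
  refine hprim.eq_pow_of_pow_eq_one ?_
  have := FiniteField.pow_card_sub_one_eq_one v hv
  rwa [hcard] at this

end CosetComplete

/-- Let `F` be a finite field with `2 ^ 13` elements and `α` a generator of its
multiplicative group. There exist fifteen 3-dimensional `𝔽₂`-subspaces of `F`
that are pairwise disjoint coset complete: each satisfies
`|ρ(Δ(X i))| = 42 = (2 ^ 3 - 1) * (2 ^ 3 - 2)`, and the coset difference sets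
`ρ(Δ(X i))` are pairwise disjoint. -/
theorem exists_fifteen_disjoint_coset_complete (F : Type*) [Field F] [Fintype F]
    [CharP F 2] [Algebra (ZMod 2) F]
    (hcard : Fintype.card F = 2 ^ 13) (α : F) (hα : orderOf α = 2 ^ 13 - 1) :
    ∃ X : Fin 15 → Submodule (ZMod 2) F,
      (∀ i, Module.finrank (ZMod 2) (X i) = 3) ∧
      (∀ i, (rho 13 '' diffSet 13 α (X i : Set F)).ncard = 42) ∧
      ∀ i j, i ≠ j →
        (rho 13 '' diffSet 13 α (X i : Set F)) ∩
          (rho 13 '' diffSet 13 α (X j : Set F)) = ∅ := by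
  have h2 : (2 : F) = 0 := CharTwo.two_eq_zero
  obtain ⟨b, hb⟩ := CosetComplete.exists_root F h2 hcard
  have hord := CosetComplete.orderOf_root h2 hcard hb
  obtain ⟨k, -, hk⟩ := CosetComplete.exists_pow_eq hcard hord α
    (CosetComplete.ne_zero_of_orderOf hα)
  exact ⟨CosetComplete.blockSpace h2 hb, CosetComplete.finrank_blockSpace h2 hb hord,
    CosetComplete.ncard_rho_image_diffSet h2 hb hα hk hord
      (CosetComplete.exists_pow_eq hcard hα),
    fun _ _ hij => CosetComplete.disjoint_rho_image_diffSet h2 hb hk hord hij⟩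
end

section
/- There exists a Steiner structure S_2[2, 3, 13]: a set S of 3-dimensional F_2-subspaces of the vector space F_2^13 such that every 2-dimensional F_2-subspace of F_2^13 is contained in exactly one member of S. -/
open Module

/-- A Steiner structure on a vector space transports along a linear equivalence. -/
theorem exists_steiner_of_linearEquiv {F V W : Type*} [Field F] [AddCommGroup V] [Module F V]
    [AddCommGroup W] [Module F W] (e : V ≃ₗ[F] W) (t k : ℕ)
    (h : ∃ S : Set (Submodule F V), (∀ B ∈ S, finrank F B = k) ∧
      ∀ T : Submodule F V, finrank F T = t → ∃! B, B ∈ S ∧ T ≤ B) :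
    ∃ S : Set (Submodule F W), (∀ B ∈ S, finrank F B = k) ∧
      ∀ T : Submodule F W, finrank F T = t → ∃! B, B ∈ S ∧ T ≤ B := by
  obtain ⟨S, hk, hS⟩ := h
  let φ := Submodule.orderIsoMapComap e.symm
  have hφ : ∀ B, finrank F (φ B) = finrank F B := fun B => e.symm.finrank_map_eq B
  refine ⟨φ ⁻¹' S, fun B hB => (hφ B).symm.trans (hk _ hB), fun T hT => ?_⟩
  obtain ⟨B, ⟨hB, hTB⟩, huniq⟩ := hS (φ T) ((hφ T).trans hT)
  refine ⟨φ.symm B, ⟨by simpa using hB, φ.le_symm_apply.2 hTB⟩, fun C hC => ?_⟩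
  exact φ.eq_symm_apply.2 (huniq _ ⟨hC.1, φ.le_iff_le.2 hC.2⟩)

section DifferenceFamily

variable {K ι : Type*} [Field K] [Algebra (ZMod 2) K]

/-- The subspace whose nonzero vectors are the `(x t) ^ 2 ^ j` scaled by `s`. -/
def scaledFrobeniusBlock (x : Fin 7 → K)
    (hx : ∀ t t', t ≠ t' → ∃ u, x t + x t' = x u) (j : ℕ) (s : K) : Submodule (ZMod 2) K :=
  AddSubgroup.toZModSubmodule 2
    { carrier := {y | y = 0 ∨ ∃ t, y = s * x t ^ 2 ^ j}
      zero_mem' := Or.inl rfl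
      add_mem' := by
        have : CharP K 2 := charP_of_injective_algebraMap (algebraMap (ZMod 2) K).injective 2
        rintro a b (rfl | ⟨t, rfl⟩) (rfl | ⟨t', rfl⟩)
        · simp
        · exact Or.inr ⟨t', by simp⟩
        · exact Or.inr ⟨t, by simp⟩
        · rcases eq_or_ne t t' with rfl | h
          · exact Or.inl (CharTwo.add_self_eq_zero _)
          · obtain ⟨u, hu⟩ := hx t t' h
            exact Or.inr ⟨u, by rw [← hu, add_pow_char_pow, mul_add]⟩
      neg_mem' := by
        have : CharP K 2 := charP_of_injective_algebraMap (algebraMap (ZMod 2) K).injective 2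
        intro a ha
        rwa [CharTwo.neg_eq] }

theorem mem_scaledFrobeniusBlock {x : Fin 7 → K}
    {hx : ∀ t t', t ≠ t' → ∃ u, x t + x t' = x u} {j : ℕ} {s y : K} :
    y ∈ scaledFrobeniusBlock x hx j s ↔ y = 0 ∨ ∃ t, y = s * x t ^ 2 ^ j :=
  Iff.rfl

theorem finrank_scaledFrobeniusBlock [Finite K] {x : Fin 7 → K}
    {hx : ∀ t t', t ≠ t' → ∃ u, x t + x t' = x u} {j : ℕ} {s : K} (hs : s ≠ 0)
    (hx0 : ∀ t, x t ≠ 0) (hinj : Function.Injective fun t => x t ^ 2 ^ j) :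
    finrank (ZMod 2) (scaledFrobeniusBlock x hx j s) = 3 := by
  have hcard : Nat.card (scaledFrobeniusBlock x hx j s) = 2 ^ 3 := by
    let f : Option (Fin 7) → scaledFrobeniusBlock x hx j s := fun o =>
      o.elim 0 fun t => ⟨s * x t ^ 2 ^ j, Or.inr ⟨t, rfl⟩⟩
    have hf : Function.Bijective f := by
      constructor
      · rintro (_ | t) (_ | t') h
        · rfl
        · exact absurd (congrArg Subtype.val h).symm (mul_ne_zero hs (pow_ne_zero _ (hx0 t')))
        · exact absurd (congrArg Subtype.val h) (mul_ne_zero hs (pow_ne_zero _ (hx0 t)))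
        · exact congrArg some (hinj (mul_left_cancel₀ hs (congrArg Subtype.val h)))
      · rintro ⟨y, hy⟩
        rcases mem_scaledFrobeniusBlock.1 hy with rfl | ⟨t, rfl⟩
        · exact ⟨none, rfl⟩
        · exact ⟨some t, rfl⟩
    rw [← Nat.card_congr (Equiv.ofBijective f hf)]
    simp
  have h := Module.natCard_eq_pow_finrank (K := ZMod 2) (V := scaledFrobeniusBlock x hx j s)
  rw [hcard, Nat.card_zmod] at h
  exact (Nat.pow_right_injective le_rfl h).symm

/-- Suppose that the quotients of distinct elements of the base blocks `x i`, together with their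
conjugates under the Frobenius map, exhaust the elements of `K` other than `0` and `1`, and that
there are just enough of them. Then the images of the base blocks under scalings and powers
of the Frobenius map form a Steiner structure `S₂[2, 3, n]`. -/
theorem exists_steiner_of_difference_family [Fintype ι] [Finite K] {n : ℕ}
    (hK : Nat.card K = Fintype.card ι * n * 42 + 2)
    (x : ι → Fin 7 → K) (hx0 : ∀ i t, x i t ≠ 0)
    (hx : ∀ i t t', t ≠ t' → ∃ u, x i t + x i t' = x i u)
    (hcover : ∀ c : K, c ≠ 0 → c ≠ 1 →
      ∃ i, ∃ j < n, ∃ t t', t ≠ t' ∧ x i t' ^ 2 ^ j = c * x i t ^ 2 ^ j) :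
    ∃ S : Set (Submodule (ZMod 2) K), (∀ B ∈ S, finrank (ZMod 2) B = 3) ∧
      ∀ T : Submodule (ZMod 2) K, finrank (ZMod 2) T = 2 → ∃! B, B ∈ S ∧ T ≤ B := by
  classical
  have := Fintype.ofFinite K
  let I := ι × Fin n × {p : Fin 7 × Fin 7 // p.1 ≠ p.2}
  let q : I → K := fun a => x a.1 a.2.2.1.2 ^ 2 ^ (a.2.1 : ℕ) / x a.1 a.2.2.1.1 ^ 2 ^ (a.2.1 : ℕ)
  have hpow : ∀ i t (j : ℕ), x i t ^ 2 ^ j ≠ 0 := fun i t j => pow_ne_zero _ (hx0 i t)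
  have hI : Fintype.card I = Fintype.card ι * n * 42 := by
    have : Fintype.card {p : Fin 7 × Fin 7 // p.1 ≠ p.2} = 42 := by decide
    simp only [I, Fintype.card_prod, this, Fintype.card_fin, mul_assoc]
  let U : Finset K := Finset.univ \ {0, 1}
  have hU : U.card = Fintype.card I := by
    rw [Finset.card_sdiff_of_subset (Finset.subset_univ _), Finset.card_pair zero_ne_one,
      Finset.card_univ, ← Nat.card_eq_fintype_card, hK, hI, Nat.add_sub_cancel]
  have hsub : U ⊆ Finset.univ.image q := by
    intro c hc
    simp only [U, Finset.mem_sdiff, Finset.mem_univ, Finset.mem_insert, Finset.mem_singleton,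
      true_and, not_or] at hc
    obtain ⟨i, j, hj, t, t', htt, h⟩ := hcover c hc.1 hc.2
    exact Finset.mem_image.2 ⟨(i, ⟨j, hj⟩, ⟨(t, t'), htt⟩), Finset.mem_univ _,
      (div_eq_iff (hpow i t j)).2 h⟩
  have hle : (Finset.univ.image q).card ≤ U.card := hU ▸ Finset.card_image_le
  have himage : U = Finset.univ.image q := Finset.eq_of_subset_of_card_le hsub hle
  have hqinj : Function.Injective q := fun a b h =>
    Finset.card_image_iff.1 (show (Finset.univ.image q).card = Finset.univ.card by
      rw [← himage, hU, Finset.card_univ]) (by simp) (by simp) h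
  have hq1 : ∀ a, q a ≠ 1 := fun a ha => by
    have : q a ∈ U := himage ▸ Finset.mem_image_of_mem q (Finset.mem_univ a)
    simp [U, ha] at this
  have hinj : ∀ i, ∀ j < n, Function.Injective fun t => x i t ^ 2 ^ j := by
    intro i j hj t t' h
    by_contra htt
    refine hq1 (i, ⟨j, hj⟩, ⟨(t, t'), htt⟩) ?_
    exact (div_eq_one_iff_eq (hpow i t j)).2 h.symm
  refine ⟨{B | ∃ i, ∃ j < n, ∃ s, s ≠ 0 ∧ B = scaledFrobeniusBlock (x i) (hx i) j s}, ?_, ?_⟩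
  · rintro _ ⟨i, j, hj, s, hs, rfl⟩
    exact finrank_scaledFrobeniusBlock hs (hx0 i) (hinj i j hj)
  · intro T hT
    let b := Module.finBasisOfFinrankEq (ZMod 2) T hT
    have ha0 : (b 0 : K) ≠ 0 := fun h => b.ne_zero 0 (Subtype.ext h)
    have hb0 : (b 1 : K) ≠ 0 := fun h => b.ne_zero 1 (Subtype.ext h)
    have hab : (b 1 : K) ≠ b 0 := fun h =>
      absurd (b.injective (Subtype.ext h)) (by decide)
    have hTB : ∀ B : Submodule (ZMod 2) K, T ≤ B ↔ (b 0 : K) ∈ B ∧ (b 1 : K) ∈ B := by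
      refine fun B => ⟨fun h => ⟨h (b 0).2, h (b 1).2⟩, fun h y hy => ?_⟩
      have := congrArg Subtype.val (b.sum_repr ⟨y, hy⟩)
      rw [Fin.sum_univ_two] at this
      rw [← show _ = y from this]
      exact B.add_mem (B.smul_mem _ h.1) (B.smul_mem _ h.2)
    obtain ⟨i, j, hj, t, t', htt, h⟩ := hcover (b 1 / b 0 : K) (div_ne_zero hb0 ha0)
      (fun h => hab ((div_eq_one_iff_eq ha0).1 h))
    have hmem : ∀ i, ∀ j < n, ∀ s, s ≠ 0 → T ≤ scaledFrobeniusBlock (x i) (hx i) j s →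
        ∃ t t', t ≠ t' ∧ (b 0 : K) = s * x i t ^ 2 ^ j ∧ (b 1 : K) = s * x i t' ^ 2 ^ j := by
      intro i j _ s _ hle
      obtain ⟨h0, h1⟩ := (hTB _).1 hle
      obtain ⟨t, ht⟩ := h0.resolve_left ha0
      obtain ⟨t', ht'⟩ := h1.resolve_left hb0
      refine ⟨t, t', ?_, ht, ht'⟩
      rintro rfl
      exact hab (ht'.trans ht.symm)
    refine ⟨scaledFrobeniusBlock (x i) (hx i) j (b 0 / x i t ^ 2 ^ j),
      ⟨⟨i, j, hj, _, div_ne_zero ha0 (hpow i t j), rfl⟩, (hTB _).2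
        ⟨Or.inr ⟨t, (div_mul_cancel₀ _ (hpow i t j)).symm⟩, Or.inr ⟨t', ?_⟩⟩⟩, ?_⟩
    · rw [h]
      field_simp [hpow i t j]
    · rintro _ ⟨⟨i', j', hj', s, hs, rfl⟩, hle⟩
      obtain ⟨u, u', huu, hu, hu'⟩ := hmem i' j' hj' s hs hle
      have key : q (i', ⟨j', hj'⟩, ⟨(u, u'), huu⟩) = q (i, ⟨j, hj⟩, ⟨(t, t'), htt⟩) := by
        have h1 : q (i, ⟨j, hj⟩, ⟨(t, t'), htt⟩) = b 1 / b 0 := (div_eq_iff (hpow i t j)).2 h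
        rw [h1, hu, hu', mul_div_mul_left _ _ hs]
      have := hqinj key
      simp only [I, Prod.mk.injEq, Fin.mk.injEq, Subtype.mk.injEq] at this
      obtain ⟨rfl, rfl, rfl, rfl⟩ := this
      rw [hu, mul_div_cancel_right₀ _ (hpow _ _ _)]

end DifferenceFamily

section BinaryPolynomials

/-- The remainder modulo `X ^ 13 + X ^ 4 + X ^ 3 + X + 1` of `X` times the polynomial over
`𝔽₂` of degree less than `13` whose coefficients are the binary digits of `a`. -/
def binMulX (a : ℕ) : ℕ :=
  (2 * a % 8192) ^^^ (if a.testBit 12 then 27 else 0)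

/-- The product of `a` and the first `k` binary digits of `b`, as polynomials over `𝔽₂` modulo
`X ^ 13 + X ^ 4 + X ^ 3 + X + 1`. -/
def binMul : ℕ → ℕ → ℕ → ℕ
  | 0, _, _ => 0
  | k + 1, a, b => (if b.testBit 0 then a else 0) ^^^ binMul k (binMulX a) (b / 2)

/-- The power `X ^ e` modulo `X ^ 13 + X ^ 4 + X ^ 3 + X + 1` over `𝔽₂`, for `e < 2 ^ k`. -/
def binPowX : ℕ → ℕ → ℕ
  | 0, _ => 1
  | k + 1, e =>
    if e.testBit 0 then binMulX (binMul 13 (binPowX k (e / 2)) (binPowX k (e / 2)))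
    else binMul 13 (binPowX k (e / 2)) (binPowX k (e / 2))

variable {R : Type*} [CommRing R]

/-- The value at `r` of the polynomial whose coefficients are the first `13` binary digits
of `a`. -/
def binEval (r : R) (a : ℕ) : R :=
  ∑ i ∈ Finset.range 13, if a.testBit i then r ^ i else 0

theorem binEval_xor (h2 : (2 : R) = 0) (r : R) (a b : ℕ) :
    binEval r (a ^^^ b) = binEval r a + binEval r b := by
  rw [binEval, binEval, binEval, ← Finset.sum_add_distrib]
  refine Finset.sum_congr rfl fun i _ => ?_
  rw [Nat.testBit_xor]
  cases a.testBit i <;> cases b.testBit i <;> simp [← two_mul, h2]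

theorem binEval_zero (r : R) : binEval r 0 = 0 := by simp [binEval]

theorem binEval_one (r : R) : binEval r 1 = 1 := by
  simp [binEval, Finset.sum_range_succ, Nat.testBit, Nat.shiftRight_eq_div_pow]

theorem binEval_binMulX (h2 : (2 : R) = 0) {r : R} (hr : r ^ 13 = r ^ 4 + r ^ 3 + r + 1)
    (a : ℕ) : binEval r (binMulX a) = r * binEval r a := by
  have h27 : binEval r 27 = r ^ 13 := by
    rw [hr]
    simp [binEval, Finset.sum_range_succ, Nat.testBit, Nat.shiftRight_eq_div_pow]
    ring
  have hshift : binEval r (2 * a % 8192) =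
      ∑ i ∈ Finset.range 12, if a.testBit i then r ^ (i + 1) else 0 := by
    rw [binEval, Finset.sum_range_succ']
    have h0 : (2 * a % 2 ^ 13).testBit 0 = false := by
      rw [Nat.testBit_mod_two_pow]
      simp
    rw [show 8192 = 2 ^ 13 by norm_num, h0]
    simp only [Bool.false_eq_true, if_false, add_zero]
    refine Finset.sum_congr rfl fun i hi => ?_
    have : i + 1 < 13 := by have := Finset.mem_range.1 hi; omega
    rw [Nat.testBit_mod_two_pow, ← Nat.testBit_div_two, Nat.mul_div_cancel_left _ two_pos]
    simp [this]
  have hr12 : binEval r a = (∑ i ∈ Finset.range 12, if a.testBit i then r ^ i else 0) +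
      if a.testBit 12 then r ^ 12 else 0 := Finset.sum_range_succ _ 12
  rw [binMulX, binEval_xor h2, hshift, hr12, mul_add, Finset.mul_sum]
  congr 1
  · refine Finset.sum_congr rfl fun i _ => ?_
    split_ifs
    · ring
    · simp
  · split_ifs
    · rw [h27]
      ring
    · rw [binEval_zero, mul_zero]

theorem binEval_binMul_aux (h2 : (2 : R) = 0) {r : R} (hr : r ^ 13 = r ^ 4 + r ^ 3 + r + 1)
    (k a b : ℕ) : binEval r (binMul k a b) =
      binEval r a * ∑ i ∈ Finset.range k, if b.testBit i then r ^ i else 0 := by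
  induction k generalizing a b with
  | zero => simp [binMul, binEval_zero]
  | succ k ih =>
    rw [binMul, binEval_xor h2, ih, binEval_binMulX h2 hr, Finset.sum_range_succ', mul_add,
      add_comm, mul_comm r, mul_assoc, Finset.mul_sum]
    congr 1
    · congr 1
      refine Finset.sum_congr rfl fun i _ => ?_
      rw [Nat.testBit_div_two]
      split_ifs
      · ring
      · simp
    · split_ifs
      · simp
      · rw [binEval_zero, mul_zero]

theorem binEval_binMul (h2 : (2 : R) = 0) {r : R} (hr : r ^ 13 = r ^ 4 + r ^ 3 + r + 1)
    (a b : ℕ) : binEval r (binMul 13 a b) = binEval r a * binEval r b :=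
  binEval_binMul_aux h2 hr 13 a b

theorem binEval_binPowX (h2 : (2 : R) = 0) {r : R} (hr : r ^ 13 = r ^ 4 + r ^ 3 + r + 1)
    (k e : ℕ) (he : e < 2 ^ k) : binEval r (binPowX k e) = r ^ e := by
  induction k generalizing e with
  | zero =>
    obtain rfl : e = 0 := by simpa using he
    rw [binPowX, binEval_one, pow_zero]
  | succ k ih =>
    have he' : e / 2 < 2 ^ k := by rw [pow_succ] at he; omega
    have hmod : e.testBit 0 = decide (e % 2 = 1) := Nat.testBit_zero e
    rw [binPowX]
    split_ifs with h
    · rw [binEval_binMulX h2 hr, binEval_binMul h2 hr, ih _ he', ← pow_add, ← pow_succ']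
      congr 1
      rw [hmod, decide_eq_true_iff] at h
      omega
    · rw [binEval_binMul h2 hr, ih _ he', ← pow_add]
      congr 1
      rw [hmod, decide_eq_true_iff] at h
      omega

end BinaryPolynomials

theorem binPowX_8191 : binPowX 13 8191 = 1 := by decide +kernel

open Polynomial in
/-- The polynomial `X ^ 13 + X ^ 4 + X ^ 3 + X + 1` has a root in the field with `2 ^ 13`
elements. -/
theorem exists_pow_thirteen_eq : ∃ r : GaloisField 2 13, r ^ 13 = r ^ 4 + r ^ 3 + r + 1 := by
  have hp : Fact (Nat.Prime 2) := ⟨Nat.prime_two⟩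
  let f : (ZMod 2)[X] := X ^ 13 + X ^ 4 + X ^ 3 + X + 1
  have hdeg : f.degree = 13 := by
    simp only [f]
    compute_degree!
  have h2 : (2 : AdjoinRoot f) = 0 := 
    (map_ofNat (algebraMap (ZMod 2) (AdjoinRoot f)) 2).symm.trans
      ((congrArg _ CharTwo.two_eq_zero).trans (map_zero _))
  have hroot : AdjoinRoot.root f ^ 13 =
      AdjoinRoot.root f ^ 4 + AdjoinRoot.root f ^ 3 + AdjoinRoot.root f + 1 := by
    have h : AdjoinRoot.mk f f = 0 := AdjoinRoot.mk_self
    simp only [f, map_add, map_pow, AdjoinRoot.mk_X, map_one] at h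
    linear_combination h - (AdjoinRoot.root f ^ 4 + AdjoinRoot.root f ^ 3 + AdjoinRoot.root f + 1)
      * h2
  have hdvd : f ∣ X ^ 2 ^ 13 - X := by
    rw [← AdjoinRoot.mk_eq_zero, map_sub, map_pow, AdjoinRoot.mk_X, sub_eq_zero,
      show 2 ^ 13 = 8191 + 1 by norm_num, pow_succ,
      ← binEval_binPowX h2 hroot 13 8191 (by norm_num), binPowX_8191, binEval_one, one_mul]
  have hsplit : (f.map (algebraMap (ZMod 2) (GaloisField 2 13))).Splits := by
    have hcard := GaloisField.card 2 13 (by norm_num)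
    refine Splits.of_dvd (FiniteField.isSplittingField_of_nat_card_eq 2 13 hcard).splits ?_
      (Polynomial.map_dvd _ hdvd)
    refine (Polynomial.map_ne_zero_iff (algebraMap (ZMod 2) _).injective).2 ?_
    exact FiniteField.X_pow_card_pow_sub_X_ne_zero _ (by norm_num) (by norm_num)
  obtain ⟨r, hr⟩ := hsplit.exists_eval_eq_zero (by rw [degree_map, hdeg]; norm_num)
  have htwo : (2 : GaloisField 2 13) = 0 := CharTwo.two_eq_zero
  refine ⟨r, ?_⟩
  simp only [f, Polynomial.map_add, Polynomial.map_pow, map_X, Polynomial.map_one, eval_add,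
    eval_pow, eval_X, eval_one] at hr
  linear_combination hr - (r ^ 4 + r ^ 3 + r + 1) * htwo

/-- The roots of `X ^ 13 + X ^ 4 + X ^ 3 + X + 1` are primitive elements. -/
theorem exists_pow_eq_of_ne_zero {r : GaloisField 2 13} (hr : r ^ 13 = r ^ 4 + r ^ 3 + r + 1)
    {c : GaloisField 2 13} (hc : c ≠ 0) : ∃ d < 8191, r ^ d = c := by
  have hp : Fact (Nat.Prime 2) := ⟨Nat.prime_two⟩
  have h2 : (2 : GaloisField 2 13) = 0 := CharTwo.two_eq_zero
  have hcard : Nat.card (GaloisField 2 13)ˣ = 8191 := by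
    rw [Nat.card_units, GaloisField.card 2 13 (by norm_num)]
    norm_num
  have hprime : Fact (Nat.Prime 8191) := ⟨by norm_num⟩
  have hr0 : r ≠ 0 := by
    rintro rfl
    simp at hr
  have hr1 : r ≠ 1 := by
    rintro rfl
    exact one_ne_zero (α := GaloisField 2 13) (by linear_combination hr + 2 * h2)
  have hu : Units.mk0 r hr0 ≠ 1 := fun h => hr1 (congrArg Units.val h)
  have hmem : Units.mk0 c hc ∈ Submonoid.powers (Units.mk0 r hr0) :=
    mem_powers_of_prime_card (p := 8191) hcard hu
  obtain ⟨d, hd⟩ := hmem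
  have hd' : r ^ d = c := congrArg Units.val hd
  have h8191 : r ^ 8191 = 1 := by
    rw [← binEval_binPowX h2 hr 13 8191 (by norm_num), binPowX_8191, binEval_one]
  have hlt : d % 8191 < 8191 := Nat.mod_lt d (Nat.succ_pos _)
  refine ⟨d % 8191, hlt, ?_⟩
  rw [← hd', pow_eq_pow_mod d h8191]

section Blocks

/-- The bitwise disjunction of `f 0, …, f (n - 1)`. -/
def orRange : ℕ → (ℕ → ℕ) → ℕ
  | 0, _ => 0
  | n + 1, f => orRange n f ||| f n

theorem testBit_orRange {n d : ℕ} {f : ℕ → ℕ} (h : (orRange n f).testBit d = true) :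
    ∃ k < n, (f k).testBit d = true := by
  induction n with
  | zero => simp [orRange] at h
  | succ n ih =>
    rw [orRange, Nat.testBit_or, Bool.or_eq_true] at h
    rcases h with h | h
    · obtain ⟨k, hk, hd⟩ := ih h
      exact ⟨k, hk.trans (Nat.lt_succ_self n), hd⟩
    · exact ⟨n, Nat.lt_succ_self n, h⟩

/-- The discrete logarithms of the nonzero elements of the base blocks. -/
def baseBlockLogs : List (List ℕ) :=
  [[0, 2803, 6263, 6212, 4115, 2934, 893],
   [0, 1028, 5013, 4382, 6406, 5582, 4690],
   [0, 3737, 6429, 1631, 2107, 1003, 1740],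
   [0, 492, 947, 3983, 3941, 837, 4776],
   [0, 1, 934, 5287, 6835, 2581, 3092],
   [0, 4510, 7363, 2004, 7131, 2477, 7400],
   [0, 936, 93, 3753, 7076, 4884, 3004],
   [0, 938, 6826, 487, 931, 374, 2448],
   [0, 1871, 5081, 5414, 6573, 4372, 7864],
   [0, 937, 4508, 4280, 6734, 1061, 7773],
   [0, 1869, 490, 7561, 5146, 2344, 3722],
   [0, 935, 6336, 8153, 2105, 6852, 4311],
   [0, 3, 7270, 1415, 1362, 7187, 658],
   [0, 491, 1027, 5543, 1720, 6165, 4149],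
   [0, 5, 7197, 1574, 6621, 4961, 1006]]

/-- The nonzero elements of the base blocks, as binary polynomials. -/
def baseBlocks : List (List ℕ) :=
  [[1, 30, 31, 1216, 1217, 1246, 1247],
   [1, 46, 47, 7770, 7771, 7796, 7797],
   [1, 34, 35, 5768, 5769, 5802, 5803],
   [1, 44, 45, 7884, 7885, 7904, 7905],
   [1, 2, 3, 556, 557, 558, 559],
   [1, 100, 101, 1202, 1203, 1238, 1239],
   [1, 12, 13, 6832, 6833, 6844, 6845],
   [1, 48, 49, 1026, 1027, 1074, 1075],
   [1, 40, 41, 4114, 4115, 4154, 4155],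
   [1, 24, 25, 1860, 1861, 1884, 1885],
   [1, 10, 11, 1746, 1747, 1752, 1753],
   [1, 6, 7, 7592, 7593, 7598, 7599],
   [1, 8, 9, 2358, 2359, 2366, 2367],
   [1, 22, 23, 8066, 8067, 8084, 8085],
   [1, 32, 33, 5382, 5383, 5414, 5415]]

/-- The discrete logarithm of the `t`-th nonzero element of the `i`-th base block. -/
def baseLog (i t : ℕ) : ℕ := (baseBlockLogs.getD i []).getD t 0

/-- The `t`-th nonzero element of the `i`-th base block, as a binary polynomial. -/
def baseElt (i t : ℕ) : ℕ := (baseBlocks.getD i []).getD t 0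

theorem baseLog_lt : ∀ i < 15, ∀ t < 7, baseLog i t < 8191 := by decide +kernel

theorem binPowX_baseLog : ∀ i < 15, ∀ t < 7, binPowX 13 (baseLog i t) = baseElt i t := by
  decide +kernel

theorem baseElt_xor : ∀ i < 15, ∀ t < 7, ∀ t' < 7, t ≠ t' →
    ∃ u < 7, baseElt i t ^^^ baseElt i t' = baseElt i u := by
  decide +kernel

/-- The set of all `2 ^ j * (baseLog i t' - baseLog i t)` modulo `8191` with `j < 13` and
`t ≠ t'`, encoded in the binary digits of a number. -/
def baseDifferences : ℕ :=
  orRange 15 fun i => orRange 13 fun j => orRange 7 fun t => orRange 7 fun t' =>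
    if t = t' then 0 else 2 ^ (2 ^ j * (baseLog i t' + 8191 - baseLog i t) % 8191)

theorem baseDifferences_or_one : baseDifferences ||| 1 = 2 ^ 8191 - 1 := by decide +kernel

theorem exists_baseLog_sub {d : ℕ} (hd0 : d ≠ 0) (hd : d < 8191) :
    ∃ i < 15, ∃ j < 13, ∃ t < 7, ∃ t' < 7, t ≠ t' ∧
      2 ^ j * (baseLog i t' + 8191 - baseLog i t) % 8191 = d := by
  have h : (baseDifferences ||| 1).testBit d = true := by
    rw [baseDifferences_or_one, Nat.testBit_two_pow_sub_one, decide_eq_true hd]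
  have h1 : Nat.testBit 1 d = false := by
    have := Nat.testBit_two_pow_of_ne (Ne.symm hd0)
    rwa [pow_zero] at this
  rw [Nat.testBit_or, h1, Bool.or_false] at h
  obtain ⟨i, hi, h⟩ := testBit_orRange h
  obtain ⟨j, hj, h⟩ := testBit_orRange h
  obtain ⟨t, ht, h⟩ := testBit_orRange h
  obtain ⟨t', ht', h⟩ := testBit_orRange h
  rcases eq_or_ne t t' with htt | htt
  · simp [htt] at h
  · rw [if_neg htt, Nat.testBit_two_pow, decide_eq_true_iff] at h
    exact ⟨i, hi, j, hj, t, ht, t', ht', htt, h⟩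

end Blocks

/-- There exists a Steiner structure `S₂[2, 3, 13]`: a set `S` of 3-dimensional
`𝔽₂`-subspaces of `𝔽₂¹³` such that every 2-dimensional `𝔽₂`-subspace of
`𝔽₂¹³` is contained in exactly one member of `S`. -/
theorem exists_steiner_structure_2_3_13 :
    ∃ S : Set (Submodule (ZMod 2) (Fin 13 → ZMod 2)),
      (∀ W ∈ S, Module.finrank (ZMod 2) W = 3) ∧
      ∀ T : Submodule (ZMod 2) (Fin 13 → ZMod 2), Module.finrank (ZMod 2) T = 2 →
        ∃! W, W ∈ S ∧ T ≤ W := by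
  have hp : Fact (Nat.Prime 2) := ⟨Nat.prime_two⟩
  have hfin : Module.finrank (ZMod 2) (GaloisField 2 13) =
      Module.finrank (ZMod 2) (Fin 13 → ZMod 2) := by
    rw [GaloisField.finrank 2 (by norm_num), Module.finrank_fin_fun]
  refine exists_steiner_of_linearEquiv (LinearEquiv.ofFinrankEq _ _ hfin) 2 3 ?_
  obtain ⟨r, hr⟩ := exists_pow_thirteen_eq
  have h2 : (2 : GaloisField 2 13) = 0 := CharTwo.two_eq_zero
  have hr0 : r ≠ 0 := by
    rintro rfl
    simp at hr
  have h8191 : r ^ 8191 = 1 := by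
    rw [← binEval_binPowX h2 hr 13 8191 (by norm_num), binPowX_8191, binEval_one]
  have heval : ∀ i < 15, ∀ t < 7, r ^ baseLog i t = binEval r (baseElt i t) := by
    intro i hi t ht
    have hlt : baseLog i t < 2 ^ 13 := (baseLog_lt i hi t ht).trans (by norm_num)
    rw [← binPowX_baseLog i hi t ht, binEval_binPowX h2 hr 13 _ hlt]
  refine exists_steiner_of_difference_family (ι := Fin 15) (n := 13) ?_
    (fun i t => r ^ baseLog i t) (fun i t => pow_ne_zero _ hr0) ?_ ?_
  · rw [GaloisField.card 2 13 (by norm_num), Fintype.card_fin]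
    norm_num
  · intro i t t' htt
    obtain ⟨u, hu, h⟩ := baseElt_xor i i.2 t t.2 t' t'.2 (Fin.val_ne_of_ne htt)
    refine ⟨⟨u, hu⟩, ?_⟩
    rw [heval i i.2 t t.2, heval i i.2 t' t'.2, heval i i.2 u hu, ← h, binEval_xor h2]
  · intro c hc0 hc1
    obtain ⟨d, hd, rfl⟩ := exists_pow_eq_of_ne_zero hr hc0
    have hd0 : d ≠ 0 := by
      rintro rfl
      exact hc1 (pow_zero r)
    obtain ⟨i, hi, j, hj, t, ht, t', ht', htt, h⟩ := exists_baseLog_sub hd0 hd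
    refine ⟨⟨i, hi⟩, j, hj, ⟨t, ht⟩, ⟨t', ht'⟩, fun h => htt (Fin.mk.inj h), ?_⟩
    have hle : baseLog i t ≤ baseLog i t' + 8191 :=
      (baseLog_lt i hi t ht).le.trans (Nat.le_add_left _ _)
    rw [← h, ← pow_eq_pow_mod _ h8191, mul_comm (2 ^ j), pow_mul, ← mul_pow, ← pow_add,
      Nat.sub_add_cancel hle, pow_add, h8191, mul_one]
end

section
/- If there exists a Steiner structure S_2[2, k, n], then there exists a Steiner system S(3, 2^k, 2^n): a collection B of subsets of size 2^k of a set with 2^n points such that every 3-element subset of the point set is contained in exactly one member of B. (Concretely, one may take the point set to be F_2^n and the blocks to be all translates v + X with v ∈ F_2^n and X ∈ S.) -/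
/-- Over `𝔽₂`, two distinct nonzero vectors are linearly independent. -/
theorem linearIndependent_pair_zmod_two {V : Type*} [AddCommGroup V] [Module (ZMod 2) V]
    {u w : V} (hu : u ≠ 0) (hw : w ≠ 0) (huw : u ≠ w) :
    LinearIndependent (ZMod 2) ![u, w] := by
  refine (LinearIndependent.pair_iff' hu).2 fun r hr => ?_
  have h : ∀ r : ZMod 2, r = 0 ∨ r = 1 := by decide
  rcases h r with rfl | rfl
  · exact hw (by rw [← hr, zero_smul])
  · exact huw (by rw [← hr, one_smul])

/-- Over `𝔽₂`, two distinct nonzero vectors span a plane. -/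
theorem finrank_span_pair_zmod_two {V : Type*} [AddCommGroup V] [Module (ZMod 2) V]
    {u w : V} (hu : u ≠ 0) (hw : w ≠ 0) (huw : u ≠ w) :
    Module.finrank (ZMod 2) (Submodule.span (ZMod 2) {u, w}) = 2 := by
  rw [← Matrix.range_cons_cons_empty u w ![],
    finrank_span_eq_card (linearIndependent_pair_zmod_two hu hw huw), Fintype.card_fin]

/-- A translate of a subspace of a finite vector space over `𝔽₂` has `2 ^ dim` elements. -/
theorem ncard_translate_zmod_two {V : Type*} [AddCommGroup V] [Module (ZMod 2) V] [Finite V]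
    (W : Submodule (ZMod 2) V) (v : V) :
    {x | x - v ∈ W}.ncard = 2 ^ Module.finrank (ZMod 2) W := by
  have h : {x | x - v ∈ W} = (fun x => x + v) '' (W : Set V) := by
    ext x
    simp [sub_eq_add_neg]
  rw [h, Set.ncard_image_of_injective _ (add_left_injective v)]
  have hcard := Module.natCard_eq_pow_finrank (K := ZMod 2) (V := W)
  rw [Nat.card_zmod] at hcard
  rw [← hcard]
  rfl

/-- If there exists a Steiner structure `S₂[2, k, n]` (a set `S` of
`k`-dimensional `𝔽₂`-subspaces of `𝔽₂ⁿ` such that every 2-dimensional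
subspace lies in exactly one member of `S`), then there exists a Steiner system
`S(3, 2 ^ k, 2 ^ n)`: a collection `B` of `2 ^ k`-element subsets of the
`2 ^ n`-element point set `𝔽₂ⁿ` such that every 3-element subset of the point
set is contained in exactly one member of `B`. -/
theorem steiner_system_of_steiner_structure (n k : ℕ) (hk : 2 ≤ k) (hkn : k ≤ n)
    (S : Set (Submodule (ZMod 2) (Fin n → ZMod 2)))
    (hdim : ∀ W ∈ S, Module.finrank (ZMod 2) W = k)
    (hSteiner : ∀ T : Submodule (ZMod 2) (Fin n → ZMod 2),
      Module.finrank (ZMod 2) T = 2 → ∃! W, W ∈ S ∧ T ≤ W) :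
    ∃ B : Set (Set (Fin n → ZMod 2)),
      (∀ b ∈ B, b.ncard = 2 ^ k) ∧
      ∀ t : Set (Fin n → ZMod 2), t.ncard = 3 → ∃! b, b ∈ B ∧ t ⊆ b := by
  refine ⟨{b | ∃ W ∈ S, ∃ v, b = {x | x - v ∈ W}}, ?_, fun t ht => ?_⟩
  · rintro b ⟨W, hW, v, rfl⟩
    rw [ncard_translate_zmod_two, hdim W hW]
  obtain ⟨a, b, c, hab, hac, hbc, rfl⟩ := Set.ncard_eq_three.1 ht
  obtain ⟨W, ⟨hWS, hTW⟩, hW⟩ := hSteiner _ (finrank_span_pair_zmod_two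
    (sub_ne_zero.2 hab.symm) (sub_ne_zero.2 hac.symm) (sub_left_injective.ne hbc))
  simp only [Submodule.span_le, Set.insert_subset_iff, Set.singleton_subset_iff,
    SetLike.mem_coe] at hTW hW
  refine ⟨{x | x - a ∈ W}, ⟨⟨W, hWS, a, rfl⟩, ?_⟩, ?_⟩
  · simp [Set.insert_subset_iff, hTW.1, hTW.2]
  · rintro _ ⟨⟨W', hW'S, v, rfl⟩, hsub⟩
    simp only [Set.insert_subset_iff, Set.singleton_subset_iff, Set.mem_ofPred_eq] at hsub
    obtain ⟨ha, hb, hc⟩ := hsub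
    obtain rfl := hW W' ⟨hW'S, by simpa using W'.sub_mem hb ha,
      by simpa using W'.sub_mem hc ha⟩
    ext x
    simpa using (W'.sub_mem_iff_left (x := x - v) ha).symm
end

section
/- There exists a Steiner system S(3, 8, 8192): a collection B of 8-element subsets of an 8192-element set such that every 3-element subset of the point set is contained in exactly one member of B. -/
/-! ### Steiner systems from families of subgroups -/

/-- If every pair of distinct nonzero elements lies in exactly one member of a family of subgroups,
every triple of points lies in exactly one coset of a member of the family. -/
theorem existsUnique_coset_of_existsUnique_subgroup {V : Type*} [AddCommGroup V]
    (S : Set (AddSubgroup V))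
    (hS : ∀ u v : V, u ≠ 0 → v ≠ 0 → u ≠ v → ∃! W, W ∈ S ∧ u ∈ W ∧ v ∈ W)
    (t : Set V) (ht : t.ncard = 3) :
    ∃! b, b ∈ {b : Set V | ∃ c, ∃ W ∈ S, b = {x | x - c ∈ W}} ∧ t ⊆ b := by
  obtain ⟨x, y, z, hxy, hxz, hyz, rfl⟩ := Set.ncard_eq_three.mp ht
  obtain ⟨W, ⟨hWS, hyW, hzW⟩, huniq⟩ := hS (y - x) (z - x) (sub_ne_zero.mpr hxy.symm)
    (sub_ne_zero.mpr hxz.symm) (fun h => hyz (sub_left_injective h))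
  refine ⟨{p | p - x ∈ W}, ⟨⟨x, W, hWS, rfl⟩, ?_⟩, ?_⟩
  · rintro p (rfl | rfl | rfl)
    · simp
    · exact hyW
    · exact hzW
  · rintro _ ⟨⟨c, W', hW', rfl⟩, hsub⟩
    have hx : x - c ∈ W' := hsub (by simp)
    have hy : y - c ∈ W' := hsub (by simp)
    have hz : z - c ∈ W' := hsub (by simp)
    have hW : W' = W := huniq W' ⟨hW', by simpa using W'.sub_mem hy hx,
      by simpa using W'.sub_mem hz hx⟩
    subst hW
    ext p
    constructor
    · intro hp
      simpa using W'.sub_mem hp hx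
    · intro hp
      simpa using W'.add_mem hp hx

theorem ncard_coset {V : Type*} [AddCommGroup V] (W : AddSubgroup V) (c : V) :
    {x | x - c ∈ W}.ncard = (W : Set V).ncard := by
  rw [← Set.ncard_image_of_injective (W : Set V) (add_left_injective c)]
  congr 1
  ext x
  simp [sub_eq_add_neg]

/-! ### Polynomials over the two-element field as natural numbers

The binary digits of a natural number are the coefficients of a polynomial. Multiplication is
carried out modulo `X ^ 13 + X ^ 4 + X ^ 3 + X + 1`, whose code is `8219`. -/

/-- The value at `α` of the polynomial coded by a natural number. -/
def evalBits {R : Type*} [CommRing R] (α : R) (m : ℕ) : R :=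
  if m = 0 then 0 else ((m % 2 : ℕ) : R) + α * evalBits α (m / 2)
termination_by m
decreasing_by omega

/-- Multiplication by the variable. -/
def mulX (m : ℕ) : ℕ := (2 * m) ^^^ (m / 4096 * 8219)

/-- The square of the polynomial formed by the lowest `k` digits. -/
def sqPoly : ℕ → ℕ → ℕ
  | 0, _ => 0
  | k + 1, m => (m % 2) ^^^ mulX (mulX (sqPoly k (m / 2)))

/-- The power of the variable whose exponent is formed by the lowest `k` digits. -/
def powX : ℕ → ℕ → ℕ
  | 0, _ => 1
  | k + 1, e =>
    if e % 2 = 0 then sqPoly 13 (powX k (e / 2)) else mulX (sqPoly 13 (powX k (e / 2)))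

theorem mulX_lt {m : ℕ} (hm : m < 8192) : mulX m < 8192 := by
  have h : (mulX m) / 2 ^ 13 = 0 := by
    rw [mulX, Nat.xor_div_two_pow]
    obtain h | h : m / 4096 = 0 ∨ m / 4096 = 1 := by omega
    · rw [h, show 2 * m / 2 ^ 13 = 0 by omega]; rfl
    · rw [h, show 2 * m / 2 ^ 13 = 1 by omega]; rfl
  omega

theorem sqPoly_lt (k m : ℕ) : sqPoly k m < 8192 := by
  induction k generalizing m with
  | zero => simp [sqPoly]
  | succ k ih =>
    exact Nat.xor_lt_two_pow (n := 13) (by omega) (mulX_lt (mulX_lt (ih _)))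

theorem powX_lt (k e : ℕ) : powX k e < 8192 := by
  cases k with
  | zero => simp [powX]
  | succ k =>
    rw [powX]
    split_ifs
    · exact sqPoly_lt _ _
    · exact mulX_lt (sqPoly_lt _ _)

section Eval

variable {R : Type*} [CommRing R] (α : R)

theorem evalBits_eq (m : ℕ) :
    evalBits α m = ((m % 2 : ℕ) : R) + α * evalBits α (m / 2) := by
  by_cases h : m = 0
  · subst h
    rw [evalBits]
    simp
  · rw [evalBits, if_neg h]

theorem evalBits_zero : evalBits α 0 = 0 := by
  rw [evalBits, if_pos rfl]

theorem evalBits_two_mul (m : ℕ) : evalBits α (2 * m) = α * evalBits α m := by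
  rw [evalBits_eq, Nat.mul_mod_right, Nat.mul_div_cancel_left m two_pos]
  simp

theorem evalBits_mod_two (m : ℕ) : evalBits α (m % 2) = ((m % 2 : ℕ) : R) := by
  rw [evalBits_eq, show m % 2 / 2 = 0 by omega, evalBits_zero]
  simp

theorem evalBits_one : evalBits α 1 = 1 := by
  simpa using evalBits_mod_two α 1

theorem evalBits_xor (h2 : (2 : R) = 0) (m n : ℕ) :
    evalBits α (m ^^^ n) = evalBits α m + evalBits α n := by
  induction m using Nat.strong_induction_on generalizing n with
  | _ m ih =>
    by_cases hm : m = 0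
    · simp [hm, evalBits_zero]
    · have hmod : (((m ^^^ n) % 2 : ℕ) : R) = ((m % 2 : ℕ) : R) + ((n % 2 : ℕ) : R) := by
        have hx := Nat.xor_mod_two_pow (a := m) (b := n) (n := 1)
        rw [pow_one] at hx
        rw [hx]
        rcases Nat.mod_two_eq_zero_or_one m with h | h <;>
          rcases Nat.mod_two_eq_zero_or_one n with h' | h' <;> simp [h, h']
        rw [one_add_one_eq_two, h2]
      rw [evalBits_eq, Nat.xor_div_two, ih (m / 2) (by omega), hmod, evalBits_eq α m,
        evalBits_eq α n]
      ring

theorem evalBits_mulX (h2 : (2 : R) = 0) (hα : α ^ 13 + α ^ 4 + α ^ 3 + α + 1 = 0) {m : ℕ}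
    (hm : m < 8192) : evalBits α (mulX m) = α * evalBits α m := by
  have h : evalBits α (m / 4096 * 8219) = 0 := by
    obtain h | h : m / 4096 = 0 ∨ m / 4096 = 1 := by omega
    · rw [h, zero_mul, evalBits_zero]
    · rw [h, one_mul, ← hα]
      simp [evalBits_eq α 8219, evalBits_eq α 4109, evalBits_eq α 2054, evalBits_eq α 1027,
        evalBits_eq α 513, evalBits_eq α 256, evalBits_eq α 128, evalBits_eq α 64,
        evalBits_eq α 32, evalBits_eq α 16, evalBits_eq α 8, evalBits_eq α 4, evalBits_eq α 2,
        evalBits_one]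
      ring
  rw [mulX, evalBits_xor α h2, h, add_zero, evalBits_two_mul]

theorem evalBits_sqPoly (h2 : (2 : R) = 0) (hα : α ^ 13 + α ^ 4 + α ^ 3 + α + 1 = 0)
    {k m : ℕ} (hm : m < 2 ^ k) : evalBits α (sqPoly k m) = evalBits α m ^ 2 := by
  induction k generalizing m with
  | zero =>
    obtain rfl : m = 0 := by simpa using hm
    simp [sqPoly, evalBits_zero]
  | succ k ih =>
    have hlt := sqPoly_lt k (m / 2)
    have hbit : ((m % 2 : ℕ) : R) ^ 2 = ((m % 2 : ℕ) : R) := by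
      rcases Nat.mod_two_eq_zero_or_one m with h | h <;> simp [h]
    rw [sqPoly, evalBits_xor α h2, evalBits_mulX α h2 hα (mulX_lt hlt),
      evalBits_mulX α h2 hα hlt, ih (by omega), evalBits_mod_two, evalBits_eq α m]
    linear_combination -hbit - (m % 2 : ℕ) * α * evalBits α (m / 2) * h2

theorem evalBits_powX (h2 : (2 : R) = 0) (hα : α ^ 13 + α ^ 4 + α ^ 3 + α + 1 = 0)
    {k e : ℕ} (he : e < 2 ^ k) : evalBits α (powX k e) = α ^ e := by
  induction k generalizing e with
  | zero =>
    obtain rfl : e = 0 := by simpa using he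
    simp [powX, evalBits_one]
  | succ k ih =>
    have hsq : evalBits α (sqPoly 13 (powX k (e / 2))) = α ^ (e / 2 * 2) := by
      rw [evalBits_sqPoly α h2 hα (powX_lt _ _), ih (by omega), pow_mul]
    rw [powX]
    split_ifs with h
    · rw [hsq]
      congr 1
      omega
    · rw [evalBits_mulX α h2 hα (sqPoly_lt _ _), hsq, ← pow_succ']
      congr 1
      omega

theorem pow_8192_eq (h2 : (2 : R) = 0) (hα : α ^ 13 + α ^ 4 + α ^ 3 + α + 1 = 0) :
    α ^ 8192 = α := by
  have hpow : powX 14 8192 = 2 * 1 := by decide +kernel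
  rw [← evalBits_powX α h2 hα (k := 14) (by norm_num), hpow, evalBits_two_mul, evalBits_one,
    mul_one]

end Eval

open Polynomial in
theorem exists_root_galoisField :
    ∃ α : GaloisField 2 13, α ^ 13 + α ^ 4 + α ^ 3 + α + 1 = 0 := by
  let f : (ZMod 2)[X] := X ^ 13 + X ^ 4 + X ^ 3 + X + 1
  have hroot : (AdjoinRoot.root f) ^ 13 + (AdjoinRoot.root f) ^ 4 + (AdjoinRoot.root f) ^ 3 +
      AdjoinRoot.root f + 1 = 0 := by
    rw [← AdjoinRoot.mk_X]
    simpa only [f, map_add, map_pow, map_one] using AdjoinRoot.mk_self (f := f)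
  have h2 : (2 : AdjoinRoot f) = 0 := by
    have h : (2 : ZMod 2) = 0 := rfl
    rw [← map_ofNat (AdjoinRoot.of f) 2, h, map_zero]
  have hdvd : f ∣ X ^ 2 ^ 13 - X := by
    rw [← AdjoinRoot.mk_eq_zero, map_sub, map_pow, AdjoinRoot.mk_X]
    exact sub_eq_zero.mpr (pow_8192_eq _ h2 hroot)
  have hne : (X ^ 2 ^ 13 - X : (ZMod 2)[X]) ≠ 0 :=
    FiniteField.X_pow_card_pow_sub_X_ne_zero _ (by norm_num) (by norm_num)
  have hsplit : Splits (f.map (algebraMap (ZMod 2) (GaloisField 2 13))) := by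
    have h := FiniteField.splits_X_pow_nat_card_sub_X 2 (K := GaloisField 2 13)
    rw [GaloisField.card 2 13 (by norm_num)] at h
    exact h.of_dvd (Polynomial.map_ne_zero hne) (Polynomial.map_dvd _ hdvd)
  have hdeg : f.degree = 13 := by
    unfold f
    compute_degree!
  obtain ⟨α, hα⟩ := hsplit.exists_eval_eq_zero (by simp [hdeg])
  exact ⟨α, by simpa [f] using hα⟩

theorem orderOf_units_galoisField {u : (GaloisField 2 13)ˣ} (hu : u ≠ 1) :
    orderOf u = 8191 ∧ ∀ v, ∃ n : ℕ, u ^ n = v := by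
  have : Fact (Nat.Prime 8191) := ⟨by norm_num⟩
  have hcard : Nat.card (GaloisField 2 13)ˣ = 8191 := by
    rw [Nat.card_units, GaloisField.card _ _ (by norm_num)]
    norm_num
  refine ⟨orderOf_eq_prime (hcard ▸ pow_card_eq_one') hu, fun v => ?_⟩
  exact mem_powers_of_prime_card hcard hu

theorem exists_primitive_root_galoisField :
    ∃ u : (GaloisField 2 13)ˣ, (u : GaloisField 2 13) ^ 13 + u ^ 4 + u ^ 3 + u + 1 = 0 ∧
      orderOf u = 8191 ∧ ∀ v, ∃ n : ℕ, u ^ n = v := by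
  obtain ⟨α, hα⟩ := exists_root_galoisField
  have hα0 : α ≠ 0 := by
    rintro rfl
    simp at hα
  refine ⟨Units.mk0 α hα0, hα, orderOf_units_galoisField fun h => ?_⟩
  obtain rfl : α = 1 := by simpa using congrArg Units.val h
  have h2 : (2 : GaloisField 2 13) = 0 := CharTwo.two_eq_zero
  exact one_ne_zero (α := GaloisField 2 13) (by linear_combination hα - 2 * h2)

/-! ### The base blocks -/

/-- Exponents of fifteen base blocks: the powers of a primitive element with exponents in a row
are the nonzero vectors of a three-dimensional binary space. -/
def baseExponent : Fin 15 → Fin 7 → ℕ :=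
  ![![0, 6337, 3007, 2802, 2175, 2436, 1793],
    ![0, 95, 1432, 7140, 4067, 1778, 3346],
    ![0, 937, 3267, 4508, 7857, 2156, 3522],
    ![0, 1871, 4637, 5081, 5276, 2399, 4150],
    ![0, 2654, 5414, 6122, 6573, 6009, 7471],
    ![0, 3, 8108, 7270, 2283, 6859, 1609],
    ![0, 1869, 2142, 490, 5820, 6130, 1694],
    ![0, 1029, 7305, 4408, 7094, 4471, 4706],
    ![0, 7271, 3999, 6206, 6604, 6126, 4419],
    ![0, 492, 3854, 947, 6493, 6125, 698],
    ![0, 1, 3917, 934, 2404, 5456, 5216],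
    ![0, 935, 5810, 6336, 2779, 7377, 3757],
    ![0, 491, 5481, 1027, 3403, 7039, 3719],
    ![0, 6208, 2259, 220, 3668, 3369, 2293],
    ![0, 939, 4013, 290, 1593, 561, 2146]]

theorem powX_baseExponent_xor (i : Fin 15) (k l : Fin 7) :
    k = l ∨ ∃ m, powX 13 (baseExponent i k) ^^^ powX 13 (baseExponent i l) =
      powX 13 (baseExponent i m) := by
  revert i k l
  decide +kernel

theorem baseExponent_lt (i : Fin 15) (k : Fin 7) : baseExponent i k < 2 ^ 13 := by
  revert i k
  decide +kernel

/-- Sums of distinct vectors of a base block stay in the block. -/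
theorem exists_pow_baseExponent_add {R : Type*} [CommRing R] (α : R) (h2 : (2 : R) = 0)
    (hα : α ^ 13 + α ^ 4 + α ^ 3 + α + 1 = 0) (i : Fin 15) {k l : Fin 7} (hkl : k ≠ l) :
    ∃ m, α ^ baseExponent i k + α ^ baseExponent i l = α ^ baseExponent i m := by
  obtain ⟨m, hm⟩ := (powX_baseExponent_xor i k l).resolve_left hkl
  refine ⟨m, ?_⟩
  simp only [← evalBits_powX α h2 hα (baseExponent_lt i _), ← hm, evalBits_xor α h2]

/-- Checks that the entries of a list are distinct and are not among the set digits of `acc`. -/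
def nodupBits : ℕ → List ℕ → Bool
  | _, [] => true
  | acc, v :: l => !acc.testBit v && nodupBits (acc ||| 1 <<< v) l

theorem nodup_of_nodupBits {acc : ℕ} {l : List ℕ} (h : nodupBits acc l = true) :
    l.Nodup ∧ ∀ v ∈ l, acc.testBit v = false := by
  induction l generalizing acc with
  | nil => simp
  | cons v l ih =>
    simp only [nodupBits, Bool.and_eq_true, Bool.not_eq_true'] at h
    obtain ⟨hl, hacc⟩ := ih h.2
    refine ⟨List.nodup_cons.mpr ⟨fun hv => ?_, hl⟩, ?_⟩
    · simpa [Nat.testBit_shiftLeft] using hacc v hv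
    · intro w hw
      rcases List.mem_cons.mp hw with rfl | hw
      · exact h.1
      · have := hacc w hw
        rw [Nat.testBit_or, Bool.or_eq_false_iff] at this
        exact this.1

/-- The thirteenth power modulo `8191` of the difference of two exponents in a base block. -/
def differenceKey (t : Fin 15 × Fin 7 × Fin 7) : ℕ :=
  (baseExponent t.1 t.2.1 + 8190 * baseExponent t.1 t.2.2) ^ 13 % 8191

theorem differenceKey_injOn : Set.InjOn differenceKey {t | t.2.1 ≠ t.2.2} := by
  have h : nodupBits 0 (((List.finRange 15 ×ˢ (List.finRange 7 ×ˢ List.finRange 7)).filter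
      fun t => t.2.1 ≠ t.2.2).map differenceKey) = true := by decide +kernel
  have hmem : ∀ t : Fin 15 × Fin 7 × Fin 7,
      t ∈ List.finRange 15 ×ˢ (List.finRange 7 ×ˢ List.finRange 7) := by
    rintro ⟨i, k, l⟩
    exact List.pair_mem_product.mpr ⟨List.mem_finRange i,
      List.pair_mem_product.mpr ⟨List.mem_finRange k, List.mem_finRange l⟩⟩
  intro s hs t ht hst
  exact List.inj_on_of_nodup_map (nodup_of_nodupBits h).1
    (List.mem_filter.mpr ⟨hmem s, decide_eq_true hs⟩)
    (List.mem_filter.mpr ⟨hmem t, decide_eq_true ht⟩) hst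

theorem differenceKey_cast (t : Fin 15 × Fin 7 × Fin 7) :
    (differenceKey t : ZMod 8191) =
      ((baseExponent t.1 t.2.1 : ZMod 8191) - baseExponent t.1 t.2.2) ^ 13 := by
  have h : (8190 : ZMod 8191) = -1 := by decide
  rw [differenceKey, ZMod.natCast_mod]
  push_cast
  rw [h]
  ring

theorem eq_of_baseExponent_sub_pow_eq {t t' : Fin 15 × Fin 7 × Fin 7}
    (ht : t.2.1 ≠ t.2.2) (ht' : t'.2.1 ≠ t'.2.2)
    (h : ((baseExponent t.1 t.2.1 : ZMod 8191) - baseExponent t.1 t.2.2) ^ 13 =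
      ((baseExponent t'.1 t'.2.1 : ZMod 8191) - baseExponent t'.1 t'.2.2) ^ 13) : t = t' := by
  rw [← differenceKey_cast, ← differenceKey_cast, ZMod.natCast_eq_natCast_iff'] at h
  refine differenceKey_injOn ht ht' ?_
  simpa [differenceKey] using h

theorem baseExponent_sub_ne_zero (i : Fin 15) {k l : Fin 7} (hkl : k ≠ l) :
    (baseExponent i k : ZMod 8191) - baseExponent i l ≠ 0 := by
  intro h
  have h' : (baseExponent i l : ZMod 8191) - baseExponent i k = 0 := by
    rw [← neg_sub, h, neg_zero]
  have := eq_of_baseExponent_sub_pow_eq (t := (i, k, l)) (t' := (i, l, k)) hkl hkl.symm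
    (by simp [h, h'])
  simp only [Prod.mk.injEq] at this
  exact hkl this.2.1

instance : Fact (Nat.Prime 8191) := ⟨by norm_num⟩

theorem two_pow_injective : Function.Injective fun j : Fin 13 => (2 : ZMod 8191) ^ (j : ℕ) := by
  decide +kernel

/-- The differences within the translates of the base blocks by powers of two. -/
def difference (t : Fin 15 × {p : Fin 7 × Fin 7 // p.1 ≠ p.2} × Fin 13) :
    {d : ZMod 8191 // d ≠ 0} :=
  ⟨2 ^ (t.2.2 : ℕ) * (baseExponent t.1 t.2.1.1.1 - baseExponent t.1 t.2.1.1.2),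
    mul_ne_zero (pow_ne_zero _ (by decide)) (baseExponent_sub_ne_zero _ t.2.1.2)⟩

theorem difference_bijective : Function.Bijective difference := by
  rw [Fintype.bijective_iff_injective_and_card]
  constructor
  · rintro ⟨i, ⟨⟨k, l⟩, hkl⟩, j⟩ ⟨i', ⟨⟨k', l'⟩, hkl'⟩, j'⟩ h
    have h := congrArg Subtype.val h
    simp only [difference] at h
    have h13 : ∀ j : ℕ, ((2 : ZMod 8191) ^ j) ^ 13 = 1 := fun j => by
      rw [← pow_mul, mul_comm, pow_mul, show (2 : ZMod 8191) ^ 13 = 1 by decide, one_pow]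
    have hpow := congrArg (fun x : ZMod 8191 => x ^ 13) h
    simp only [mul_pow _ _ 13, h13, one_mul] at hpow
    have key := eq_of_baseExponent_sub_pow_eq (t := (i, k, l)) (t' := (i', k', l')) hkl hkl' hpow
    simp only [Prod.mk.injEq] at key
    obtain ⟨rfl, rfl, rfl⟩ := key
    obtain rfl : j = j' :=
      two_pow_injective (mul_right_cancel₀ (baseExponent_sub_ne_zero i hkl) h)
    rfl
  · have h42 : Fintype.card {p : Fin 7 × Fin 7 // p.1 ≠ p.2} = 42 := by decide
    have h8190 : Fintype.card {d : ZMod 8191 // d ≠ 0} = 8190 := by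
      rw [Fintype.card_subtype_compl, ZMod.card, Fintype.card_subtype_eq]
    rw [Fintype.card_prod, Fintype.card_prod, h42, h8190]
    simp

/-- The base blocks develop into a family in which every pair is covered exactly once. -/
theorem existsUnique_development {a b : ZMod 8191} (hab : a ≠ b) :
    ∃! w : Fin 15 × Fin 13 × ZMod 8191,
      (∃ k, a = w.2.2 + 2 ^ (w.2.1 : ℕ) * baseExponent w.1 k) ∧
        ∃ l, b = w.2.2 + 2 ^ (w.2.1 : ℕ) * baseExponent w.1 l := by
  obtain ⟨⟨i, ⟨⟨k, l⟩, hkl⟩, j⟩, h⟩ := difference_bijective.2 ⟨a - b, sub_ne_zero.mpr hab⟩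
  have hval := congrArg Subtype.val h
  simp only [difference] at hval
  refine ⟨(i, j, a - 2 ^ (j : ℕ) * baseExponent i k), ⟨⟨k, by ring⟩, l, ?_⟩, ?_⟩
  · linear_combination hval
  · rintro ⟨i', j', s⟩ ⟨⟨k', hk'⟩, l', hl'⟩
    simp only at hk' hl'
    have hkl' : k' ≠ l' := by
      rintro rfl
      exact hab (hk'.trans hl'.symm)
    have := difference_bijective.1 (a₁ := (i', ⟨(k', l'), hkl'⟩, j'))
      (a₂ := (i, ⟨(k, l), hkl⟩, j)) (by
        rw [h]
        refine Subtype.ext ?_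
        simp only [difference]
        rw [hk', hl']
        ring)
    simp only [Prod.mk.injEq, Subtype.mk.injEq] at this
    obtain ⟨rfl, ⟨rfl, rfl⟩, rfl⟩ := this
    rw [hk']
    simp

/-! ### The subspaces -/

/-- The development of a base block, as an additive subgroup. -/
def blockSubgroup {F : Type*} [CommRing F] [CharP F 2] (α : F)
    (hα : α ^ 13 + α ^ 4 + α ^ 3 + α + 1 = 0) (w : Fin 15 × Fin 13 × ZMod 8191) :
    AddSubgroup F where
  carrier := Set.range fun o : Option (Fin 7) =>
    o.elim 0 fun k => α ^ (w.2.2.val + 2 ^ (w.2.1 : ℕ) * baseExponent w.1 k)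
  zero_mem' := ⟨none, rfl⟩
  neg_mem' := by
    intro x hx
    rwa [CharTwo.neg_eq]
  add_mem' := by
    rintro _ _ ⟨_ | k, rfl⟩ ⟨_ | l, rfl⟩
    · exact ⟨none, by simp⟩
    · exact ⟨some l, by simp⟩
    · exact ⟨some k, by simp⟩
    · obtain rfl | hkl := eq_or_ne k l
      · exact ⟨none, (CharTwo.add_self_eq_zero _).symm⟩
      · obtain ⟨m, hm⟩ := exists_pow_baseExponent_add α CharTwo.two_eq_zero hα w.1 hkl
        refine ⟨some m, ?_⟩
        simp only [Option.elim_some, pow_add, mul_comm (2 ^ (w.2.1 : ℕ)), pow_mul]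
        rw [← hm, add_pow_char_pow, mul_add]

section Field

variable {u : (GaloisField 2 13)ˣ}
  (hu : (u : GaloisField 2 13) ^ 13 + u ^ 4 + u ^ 3 + u + 1 = 0)

theorem unit_pow_eq_iff (hord : orderOf u = 8191) {m n : ℕ} :
    (u : GaloisField 2 13) ^ m = u ^ n ↔ (m : ZMod 8191) = n := by
  rw [← Units.val_pow_eq_pow_val, ← Units.val_pow_eq_pow_val, Units.val_inj, pow_eq_pow_iff_modEq,
    hord, ZMod.natCast_eq_natCast_iff]

theorem pow_mem_blockSubgroup (hord : orderOf u = 8191) (w : Fin 15 × Fin 13 × ZMod 8191) (n : ℕ) :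
    (u : GaloisField 2 13) ^ n ∈ blockSubgroup (u : GaloisField 2 13) hu w ↔
      ∃ k, (n : ZMod 8191) = w.2.2 + 2 ^ (w.2.1 : ℕ) * baseExponent w.1 k := by
  constructor
  · rintro ⟨_ | k, h⟩
    · exact absurd h.symm (pow_ne_zero _ u.ne_zero)
    · exact ⟨k, by simpa using ((unit_pow_eq_iff hord).mp h).symm⟩
  · rintro ⟨k, h⟩
    exact ⟨some k, (unit_pow_eq_iff hord).mpr (by simpa using h.symm)⟩

theorem ncard_blockSubgroup (hord : orderOf u = 8191) (w : Fin 15 × Fin 13 × ZMod 8191) :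
    (blockSubgroup (u : GaloisField 2 13) hu w : Set (GaloisField 2 13)).ncard = 8 := by
  have hinj : Function.Injective fun o : Option (Fin 7) =>
      o.elim (0 : GaloisField 2 13)
        fun k => (u : GaloisField 2 13) ^ (w.2.2.val + 2 ^ (w.2.1 : ℕ) * baseExponent w.1 k) := by
    rintro (_ | k) (_ | l) h
    · rfl
    · exact absurd h.symm (pow_ne_zero _ u.ne_zero)
    · exact absurd h (pow_ne_zero _ u.ne_zero)
    · by_contra hkl
      have h := (unit_pow_eq_iff hord).mp h
      push_cast at h
      exact baseExponent_sub_ne_zero w.1 (fun h => hkl (congrArg some h)) (sub_eq_zero.mpr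
        (mul_left_cancel₀ (pow_ne_zero _ (by decide)) (add_left_cancel h)))
  exact (Set.ncard_range_of_injective hinj).trans (by simp)

theorem existsUnique_blockSubgroup (hord : orderOf u = 8191) (hgen : ∀ v, ∃ n : ℕ, u ^ n = v)
    (x y : GaloisField 2 13) (hx : x ≠ 0) (hy : y ≠ 0) (hxy : x ≠ y) :
    ∃! W, W ∈ Set.range (blockSubgroup (u : GaloisField 2 13) hu) ∧ x ∈ W ∧ y ∈ W := by
  have hpow : ∀ z : GaloisField 2 13, z ≠ 0 → ∃ n : ℕ, (u : GaloisField 2 13) ^ n = z := by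
    intro z hz
    obtain ⟨n, hn⟩ := hgen (Units.mk0 z hz)
    exact ⟨n, by simpa using congrArg Units.val hn⟩
  obtain ⟨a, rfl⟩ := hpow x hx
  obtain ⟨b, rfl⟩ := hpow y hy
  obtain ⟨w, ⟨ha, hb⟩, huniq⟩ :=
    existsUnique_development (fun h => hxy ((unit_pow_eq_iff hord).mpr h))
  refine ⟨blockSubgroup _ hu w, ⟨⟨w, rfl⟩, (pow_mem_blockSubgroup hu hord w a).mpr ha,
    (pow_mem_blockSubgroup hu hord w b).mpr hb⟩, ?_⟩
  rintro _ ⟨⟨w', rfl⟩, ha', hb'⟩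
  rw [huniq w' ⟨(pow_mem_blockSubgroup hu hord w' a).mp ha',
    (pow_mem_blockSubgroup hu hord w' b).mp hb'⟩]

end Field

/-- There exists a Steiner system `S(3, 8, 8192)`: a collection `B` of
8-element subsets of an 8192-element point set such that every 3-element subset
of the point set is contained in exactly one member of `B`. -/
theorem exists_steiner_system_3_8_8192 :
    ∃ B : Set (Set (Fin 8192)),
      (∀ b ∈ B, b.ncard = 8) ∧
      ∀ t : Set (Fin 8192), t.ncard = 3 → ∃! b, b ∈ B ∧ t ⊆ b := by
  obtain ⟨u, hu, hord, hgen⟩ := exists_primitive_root_galoisField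
  let e : GaloisField 2 13 ≃ Fin 8192 :=
    Finite.equivFinOfCardEq (GaloisField.card 2 13 (by norm_num))
  let S := Set.range (blockSubgroup (u : GaloisField 2 13) hu)
  let C : Set (Set (GaloisField 2 13)) := {b | ∃ c, ∃ W ∈ S, b = {x | x - c ∈ W}}
  refine ⟨{b | e ⁻¹' b ∈ C}, ?_, fun t ht => ?_⟩
  · rintro b ⟨c, _, ⟨w, rfl⟩, hb⟩
    rw [← e.image_preimage b, Set.ncard_image_of_injective _ e.injective, hb, ncard_coset,
      ncard_blockSubgroup hu hord]
  · have ht' : (e ⁻¹' t).ncard = 3 := by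
      rw [← ht, ← Set.ncard_image_of_injective _ e.injective, e.image_preimage]
    obtain ⟨b, ⟨hb, htb⟩, huniq⟩ := existsUnique_coset_of_existsUnique_subgroup S
      (existsUnique_blockSubgroup hu hord hgen) _ ht'
    refine ⟨e '' b, ⟨?_, ?_⟩, ?_⟩
    · rwa [Set.mem_ofPred_eq, e.preimage_image]
    · rw [← e.image_preimage t]
      exact Set.image_mono htb
    · rintro b' ⟨hb', htb'⟩
      rw [← huniq _ ⟨hb', Set.preimage_mono htb'⟩, e.image_preimage]
end
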